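/- (Optimality of the first passage strategy.) Let K > 0 and assume either r > 0, or r = 0 and ℙ(lim_{t → ∞} X_t = ∞) = 1. Put m = E[e^{X̲_{e_r}}] and x* = log(K m). For x ∈ ℝ let τ* = inf{t ≥ 0 : x + X_t < x*}. Then τ* is an optimal stopping time: for every x ∈ ℝ, E[e^{−r τ*} (K − e^{x + X_{τ*}})^+ 1_{{τ* < ∞}}] = sup_{τ} E[e^{−r τ} (K − e^{x + X_τ})^+ 1_{{τ < ∞}}], the supremum being over all stopping times τ : Ω → [0, ∞] with respect to (F_t)_{t ≥ 0}. -/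

import Mathlib

open MeasureTheory ProbabilityTheory Set Filter
open scoped ENNReal NNReal Classical

noncomputable section

namespace AKLevy

variable {Ω : Type*}

/-- Running supremum `X̄_t = sup_{0 ≤ s ≤ t} X_s` of a process. -/
def runSup (X : ℝ → Ω → ℝ) (t : ℝ) (ω : Ω) : ℝ :=
  sSup ((fun s => X s ω) '' Set.Icc 0 t)

/-- Running infimum `X̲_t = inf_{0 ≤ s ≤ t} X_s` of a process. -/
def runInf (X : ℝ → Ω → ℝ) (t : ℝ) (ω : Ω) : ℝ :=
  sInf ((fun s => X s ω) '' Set.Icc 0 t)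

/-- All-time supremum `X̄_∞ = sup_{t ≥ 0} X_t`. -/
def supAll (X : ℝ → Ω → ℝ) (ω : Ω) : ℝ :=
  sSup ((fun s => X s ω) '' Set.Ici 0)

/-- All-time infimum `X̲_∞ = inf_{t ≥ 0} X_t`. -/
def infAll (X : ℝ → Ω → ℝ) (ω : Ω) : ℝ :=
  sInf ((fun s => X s ω) '' Set.Ici 0)

/-- `X` is a real-valued Lévy process with respect to the filtration `ℱ`,
on a filtered probability space satisfying the usual conditions. -/
structure IsLevy [m0 : MeasurableSpace Ω] (P : Measure Ω) (ℱ : Filtration ℝ m0)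
    (X : ℝ → Ω → ℝ) : Prop where
  isProb : IsProbabilityMeasure P
  adapted : ∀ t : ℝ, 0 ≤ t → StronglyMeasurable[ℱ t] (X t)
  zero : ∀ᵐ ω ∂P, X 0 ω = 0
  rightCont : ∀ ω, ∀ t : ℝ, 0 ≤ t → ContinuousWithinAt (fun s => X s ω) (Set.Ici t) t
  leftLim : ∀ ω, ∀ t : ℝ, 0 < t →
    ∃ l : ℝ, Tendsto (fun s => X s ω) (nhdsWithin t (Set.Iio t)) (nhds l)
  indepIncrements : ∀ s t : ℝ, 0 ≤ s → s ≤ t →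
    Indep (MeasurableSpace.comap (fun ω => X t ω - X s ω) inferInstance) (ℱ s) P
  stationary : ∀ s t : ℝ, 0 ≤ s → s ≤ t →
    Measure.map (fun ω => X t ω - X s ω) P = Measure.map (X (t - s)) P
  filtRightCont : ∀ t : ℝ, (ℱ t : MeasurableSpace Ω) = ⨅ s ∈ Set.Ioi t, (ℱ s : MeasurableSpace Ω)
  complete : ∀ N : Set Ω, MeasurableSet N → P N = 0 → MeasurableSet[ℱ 0] N

/-- `τ_x^+ < ∞`: the process passes strictly above level `x` at some nonnegative time. -/
def hitsAbove (X : ℝ → Ω → ℝ) (x : ℝ) (ω : Ω) : Prop := ∃ t, 0 ≤ t ∧ x < X t ω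

/-- First passage time above `x`:  `τ_x^+ = inf {t ≥ 0 : X_t > x}` (junk value if never). -/
def tauAbove (X : ℝ → Ω → ℝ) (x : ℝ) (ω : Ω) : ℝ := sInf {t : ℝ | 0 ≤ t ∧ x < X t ω}

/-- `τ_x^- < ∞`: the process passes strictly below level `x` at some nonnegative time. -/
def hitsBelow (X : ℝ → Ω → ℝ) (x : ℝ) (ω : Ω) : Prop := ∃ t, 0 ≤ t ∧ X t ω < x

/-- First passage time below `x`:  `τ_x^- = inf {t ≥ 0 : X_t < x}` (junk value if never). -/
def tauBelow (X : ℝ → Ω → ℝ) (x : ℝ) (ω : Ω) : ℝ := sInf {t : ℝ | 0 ≤ t ∧ X t ω < x}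

/-- The `[0,∞]`-valued first passage time `σ_x = inf { t ≥ 0 : x + X_t < y }`, with `inf ∅ = ∞`. -/
def hitBelowE (X : ℝ → Ω → ℝ) (y x : ℝ) (ω : Ω) : ℝ≥0∞ :=
  if ∃ t, 0 ≤ t ∧ x + X t ω < y then ENNReal.ofReal (sInf {t : ℝ | 0 ≤ t ∧ x + X t ω < y})
  else ∞

/-- The stopped clock `t ∧ σ_x` (real-valued), where `σ_x = inf{ t ≥ 0 : x + X_t < y}`. -/
def stoppedClock (X : ℝ → Ω → ℝ) (y x : ℝ) (t : ℝ) (ω : Ω) : ℝ :=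
  (min (ENNReal.ofReal t) (hitBelowE X y x ω)).toReal

/-- A `[0,∞]`-valued stopping time of the filtration `ℱ`. -/
def IsStopTime [m0 : MeasurableSpace Ω] (ℱ : Filtration ℝ m0) (τ : Ω → ℝ≥0∞) : Prop :=
  ∀ t : ℝ, 0 ≤ t → MeasurableSet[ℱ t] {ω | τ ω ≤ ENNReal.ofReal t}

/-- Discounted payoff `e^{-rτ} G(x + X_τ)` at a `[0,∞]`-valued time `τ`, set to `0` on `{τ = ∞}`. -/
def stopPayoff (X : ℝ → Ω → ℝ) (r x : ℝ) (G : ℝ → ℝ) (τ : Ω → ℝ≥0∞) (ω : Ω) : ℝ :=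
  if τ ω ≠ ∞ then Real.exp (-(r * (τ ω).toReal)) * G (x + X ((τ ω).toReal) ω) else 0

/-- Discounted American put payoff `e^{-rτ}(K - e^{x + X_τ})^+ 1_{τ < ∞}`. -/
def putPayoff (X : ℝ → Ω → ℝ) (r K x : ℝ) (τ : Ω → ℝ≥0∞) (ω : Ω) : ℝ :=
  stopPayoff X r x (fun z => max (K - Real.exp z) 0) τ ω

/-- Value function `v(x) = sup_τ E[e^{-rτ}(K - e^{x+X_τ})^+ 1_{τ<∞}]`, the supremum
being over all `[0,∞]`-valued stopping times of `ℱ`. -/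
def putValue [m0 : MeasurableSpace Ω] (P : Measure Ω) (ℱ : Filtration ℝ m0)
    (X : ℝ → Ω → ℝ) (r K x : ℝ) : ℝ :=
  ⨆ τ : {τ : Ω → ℝ≥0∞ // IsStopTime ℱ τ}, ∫ ω, putPayoff X r K x τ.1 ω ∂P

/-- `m = E[e^{X̲_{e_r}}]`, where `e_r` is an independent exponential time of rate `r > 0`,
and `e_0 = ∞`. -/
def mInf [m0 : MeasurableSpace Ω] (P : Measure Ω) (X : ℝ → Ω → ℝ) (r : ℝ) : ℝ :=
  if 0 < r then
    ∫ t in Set.Ioi (0 : ℝ), r * Real.exp (-(r * t)) * (∫ ω, Real.exp (runInf X t ω) ∂P)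
  else ∫ ω, Real.exp (infAll X ω) ∂P

/-- `P(X̲_{e_r} = 0)`, where `e_r` is an independent exponential time of rate `r > 0`,
and `e_0 = ∞`. -/
def atomZeroProb [m0 : MeasurableSpace Ω] (P : Measure Ω) (X : ℝ → Ω → ℝ) (r : ℝ) : ℝ :=
  if 0 < r then
    ∫ t in Set.Ioi (0 : ℝ), r * Real.exp (-(r * t)) * (P {ω | runInf X t ω = 0}).toReal
  else (P {ω | infAll X ω = 0}).toReal

/-- The event `{τ_0^- = 0}`: `0` is (pathwise) immediately reached from below, i.e.
`inf{t ≥ 0 : X_t < 0} = 0`. -/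
def regularBelow (X : ℝ → Ω → ℝ) : Set Ω :=
  {ω | ∀ ε > (0 : ℝ), ∃ t, 0 ≤ t ∧ t < ε ∧ X t ω < 0}

/-- `E[e^{-γ X̄_{e_α}}] = ∫_0^∞ α e^{-α t} E[e^{-γ X̄_t}] dt`. -/
def expSupLT [m0 : MeasurableSpace Ω] (P : Measure Ω) (X : ℝ → Ω → ℝ) (α γ : ℝ) : ℝ :=
  ∫ t in Set.Ioi (0 : ℝ), α * Real.exp (-(α * t)) * (∫ ω, Real.exp (-(γ * runSup X t ω)) ∂P)

/-- The function `h_{α,β}(x) = E[e^{-α σ_x + β (x + X_{σ_x})} 1_{σ_x < ∞}]`, where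
`σ_x = inf{t ≥ 0 : x + X_t < 0}`. -/
def hAB [m0 : MeasurableSpace Ω] (P : Measure Ω) (X : ℝ → Ω → ℝ) (α β : ℝ) (z : ℝ) : ℝ :=
  ∫ ω, (if hitsBelow X (-z) ω then
      Real.exp (-(α * tauBelow X (-z) ω) + β * (z + X (tauBelow X (-z) ω) ω)) else 0) ∂P

/-- `v_y(x) = E[e^{-r σ_x} (K - e^{x + X_{σ_x}})^+ 1_{σ_x<∞}]` where
`σ_x = inf{t ≥ 0 : x + X_t < y}`. -/
def vy [m0 : MeasurableSpace Ω] (P : Measure Ω) (X : ℝ → Ω → ℝ) (r K y : ℝ) (z : ℝ) : ℝ :=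
  ∫ ω, putPayoff X r K z (hitBelowE X y z) ω ∂P

/-- The process `f` (indexed by `t ≥ 0`) is a martingale with respect to `ℱ` and `P`. -/
def MartOn [m0 : MeasurableSpace Ω] (P : Measure Ω) (ℱ : Filtration ℝ m0)
    (f : ℝ → Ω → ℝ) : Prop :=
  (∀ t : ℝ, 0 ≤ t → StronglyMeasurable[ℱ t] (f t)) ∧
  (∀ t : ℝ, 0 ≤ t → Integrable (f t) P) ∧
  ∀ s t : ℝ, 0 ≤ s → s ≤ t → P[f t|ℱ s] =ᵐ[P] f s

/-- The process `f` (indexed by `t ≥ 0`) is a supermartingale w.r.t. `ℱ` and `P`. -/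
def SupermartOn [m0 : MeasurableSpace Ω] (P : Measure Ω) (ℱ : Filtration ℝ m0)
    (f : ℝ → Ω → ℝ) : Prop :=
  (∀ t : ℝ, 0 ≤ t → StronglyMeasurable[ℱ t] (f t)) ∧
  (∀ t : ℝ, 0 ≤ t → Integrable (f t) P) ∧
  ∀ s t : ℝ, 0 ≤ s → s ≤ t → P[f t|ℱ s] ≤ᵐ[P] f s

section Paths

theorem exists_nnrat_lt_of_lt {f : ℝ → ℝ} {s a ε : ℝ} (hs : 0 ≤ s)
    (hf : ContinuousWithinAt f (Ici s) s) (ha : f s < a) (hε : 0 < ε) :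
    ∃ q : ℚ≥0, s ≤ q ∧ (q : ℝ) < s + ε ∧ f q < a := by
  have h1 : ∀ᶠ u in nhdsWithin s (Ioi s), f u < a :=
    (hf.eventually_lt_const ha).filter_mono (nhdsWithin_mono _ Ioi_subset_Ici_self)
  obtain ⟨u, hu, hsub⟩ := (mem_nhdsGT_iff_exists_Ioo_subset (a := s)).1 h1
  obtain ⟨q, hq1, hq2⟩ := exists_rat_btwn (lt_min hu (lt_add_of_pos_right s hε))
  have hq0 : (0 : ℚ) ≤ q := by exact_mod_cast hs.trans hq1.le
  lift q to ℚ≥0 using hq0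
  have hc : (((q : ℚ≥0) : ℚ) : ℝ) = (q : ℝ) := by norm_cast
  rw [hc] at hq1 hq2
  exact ⟨q, hq1.le, hq2.trans_le (min_le_right _ _),
    hsub ⟨hq1, hq2.trans_le (min_le_left _ _)⟩⟩

theorem bddBelow_image_Icc {f : ℝ → ℝ}
    (hr : ∀ t, 0 ≤ t → ContinuousWithinAt f (Ici t) t)
    (hl : ∀ t, 0 < t → ∃ l : ℝ, Tendsto f (nhdsWithin t (Iio t)) (nhds l)) (T : ℝ) :
    BddBelow (f '' Icc 0 T) := by
  refine isCompact_Icc.induction_on (p := fun s => BddBelow (f '' s)) (by simp)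
    (fun s t hst ht => ht.mono (image_mono hst))
    (fun s t hs ht => by rw [image_union]; exact hs.union ht) ?_
  intro t ht
  obtain ⟨c, hc⟩ : ∃ c, ∀ᶠ u in nhdsWithin t (Ici t), c ≤ f u :=
    ⟨f t - 1, ((hr t ht.1).eventually_const_lt (sub_one_lt (f t))).mono fun _ h => h.le⟩
  obtain ⟨d, hd⟩ : ∃ d, ∀ᶠ u in nhdsWithin t (Iio t ∩ Icc 0 T), d ≤ f u := by
    rcases ht.1.eq_or_lt with h0 | h0
    · refine ⟨0, ?_⟩
      have : Iio t ∩ Icc 0 T = ∅ := by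
        ext u; simp only [mem_inter_iff, mem_Iio, mem_Icc, mem_empty_iff_false, iff_false]
        intro h; linarith [h.1, h.2.1]
      simp [this]
    · obtain ⟨l, hl⟩ := hl t h0
      exact ⟨l - 1, ((hl.eventually_const_lt (sub_one_lt l)).mono fun _ h => h.le).filter_mono
        (nhdsWithin_mono _ inter_subset_left)⟩
  refine ⟨{u | min c d ≤ f u}, ?_, ⟨min c d, ?_⟩⟩
  · have h1 : nhdsWithin t (Icc 0 T) ≤ nhdsWithin t (Ici t ∪ (Iio t ∩ Icc 0 T)) := by
      refine nhdsWithin_mono _ fun u hu => ?_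
      rcases le_or_gt t u with h | h
      · exact Or.inl h
      · exact Or.inr ⟨h, hu⟩
    refine h1 ?_
    rw [nhdsWithin_union]
    exact ⟨hc.mono fun u h => (min_le_left _ _).trans h,
      hd.mono fun u h => (min_le_right _ _).trans h⟩
  · rintro _ ⟨u, hu, rfl⟩
    exact hu

end Paths

section Law

variable [m0 : MeasurableSpace Ω] {P : Measure Ω} {ℱ : Filtration ℝ m0} {X : ℝ → Ω → ℝ}

theorem IsLevy.measurable (hX : IsLevy P ℱ X) {t : ℝ} (ht : 0 ≤ t) : Measurable (X t) :=
  (hX.adapted t ht).measurable.mono (ℱ.le t) le_rfl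

/-- The increments after time `s`, along the nonnegative rationals. -/
def incrPath (X : ℝ → Ω → ℝ) (s : ℝ) (ω : Ω) (q : ℚ≥0) : ℝ := X (s + q) ω - X s ω

/-- The increments after time `s`, along the grid of step `h`, frozen after `n` steps. -/
def gridPath (X : ℝ → Ω → ℝ) (h s : ℝ) (n : ℕ) (ω : Ω) (j : ℕ) : ℝ :=
  X (s + (min j n : ℕ) * h) ω - X s ω

theorem IsLevy.measurable_incrPath (hX : IsLevy P ℱ X) {s : ℝ} (hs : 0 ≤ s) :
    Measurable (incrPath X s) :=
  measurable_pi_lambda _ fun _ => (hX.measurable (by positivity)).sub (hX.measurable hs)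

theorem IsLevy.measurable_gridPath (hX : IsLevy P ℱ X) {h s : ℝ} (hh : 0 ≤ h) (hs : 0 ≤ s)
    (n : ℕ) : Measurable[ℱ (s + n * h)] (gridPath X h s n) := by
  refine @measurable_pi_lambda Ω ℕ (fun _ => ℝ) (ℱ _) _ _ fun j => ?_
  have h1 : (0 : ℝ) ≤ n * h := by positivity
  have hj : s + (min j n : ℕ) * h ≤ s + n * h := by
    gcongr
    exact min_le_right _ _
  have h2 : Measurable[ℱ (s + n * h)] (X (s + (min j n : ℕ) * h)) :=
    (hX.adapted _ (by positivity)).measurable.mono (ℱ.mono hj) le_rfl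
  have h3 : Measurable[ℱ (s + n * h)] (X s) :=
    (hX.adapted s hs).measurable.mono (ℱ.mono (by linarith)) le_rfl
  exact h2.sub h3

/-- Append one increment to a path that is frozen after `n` steps. -/
def appendIncr (n : ℕ) (p : (ℕ → ℝ) × ℝ) (j : ℕ) : ℝ := if j ≤ n then p.1 j else p.1 n + p.2

theorem measurable_appendIncr (n : ℕ) : Measurable (appendIncr n) := by
  refine measurable_pi_lambda _ fun j => ?_
  unfold appendIncr
  split_ifs <;> fun_prop

theorem IsLevy.map_gridPath_succ (hX : IsLevy P ℱ X) {h s : ℝ} (hh : 0 ≤ h) (hs : 0 ≤ s)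
    (n : ℕ) {A : Set Ω} (hA : MeasurableSet[ℱ s] A) :
    (P.restrict A).map (gridPath X h s (n + 1)) =
      (((P.restrict A).map (gridPath X h s n)).prod (P.map (X h))).map (appendIncr n) := by
  have := hX.isProb
  have hnh : (0 : ℝ) ≤ n * h := by positivity
  set t : ℝ := s + n * h with ht
  set ξ : Ω → ℝ := fun ω => X (t + h) ω - X t ω with hξ
  have ht0 : 0 ≤ t := by positivity
  have mξ : Measurable ξ := (hX.measurable (by positivity)).sub (hX.measurable ht0)
  have mg : Measurable (gridPath X h s n) :=
    (hX.measurable_gridPath hh hs n).mono (ℱ.le _) le_rfl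
  have hcomp : gridPath X h s (n + 1) = appendIncr n ∘ fun ω => (gridPath X h s n ω, ξ ω) := by
    funext ω j
    simp only [gridPath, appendIncr, Function.comp, hξ, ht]
    split_ifs with hj
    · rw [min_eq_left hj, min_eq_left (by omega)]
    · rw [min_eq_right (by omega), min_self]
      push_cast
      ring_nf
  have hlaw : P.map ξ = P.map (X h) := by
    have := hX.stationary t (t + h) ht0 (by linarith)
    rwa [add_sub_cancel_left] at this
  rw [hcomp, ← Measure.map_map (measurable_appendIncr n) (mg.prodMk mξ)]
  congr 1
  symm
  have : IsProbabilityMeasure (P.map (X h)) := Measure.isProbabilityMeasure_map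
    (hX.measurable hh).aemeasurable
  refine Measure.prod_eq fun B C hB hC => ?_
  rw [Measure.map_apply (mg.prodMk mξ) (hB.prod hC), Measure.map_apply mg hB, ← hlaw,
    Measure.map_apply mξ hC, Measure.restrict_apply (mg.prodMk mξ (hB.prod hC)),
    Measure.restrict_apply (mg hB)]
  have hind := Indep_iff _ _ P |>.1 (hX.indepIncrements t (t + h) ht0 (by linarith)) (ξ ⁻¹' C)
    (gridPath X h s n ⁻¹' B ∩ A) ⟨C, hC, rfl⟩
    ((hX.measurable_gridPath hh hs n hB).inter (ℱ.mono (by linarith) _ hA))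
  rw [mul_comm, ← hind]
  congr 1
  ext ω
  simp only [mem_inter_iff, mem_preimage, mem_prod]
  tauto

theorem IsLevy.map_gridPath (hX : IsLevy P ℱ X) {h : ℝ} (hh : 0 ≤ h) (n : ℕ) {s : ℝ}
    (hs : 0 ≤ s) {A : Set Ω} (hA : MeasurableSet[ℱ s] A) :
    (P.restrict A).map (gridPath X h s n) = P A • P.map (gridPath X h 0 n) := by
  have := hX.isProb
  induction n with
  | zero =>
    have h0 : ∀ s, gridPath X h s 0 = fun _ _ => 0 := by
      intro s; funext ω j; simp [gridPath]
    rw [h0, h0, Measure.map_const, Measure.map_const]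
    simp
  | succ n ih =>
    have h1 := hX.map_gridPath_succ hh le_rfl n (A := univ) MeasurableSet.univ
    rw [Measure.restrict_univ] at h1
    rw [hX.map_gridPath_succ hh hs n hA, ih, h1, Measure.prod_smul_left, Measure.map_smul]

theorem IsLevy.map_incrPath (hX : IsLevy P ℱ X) {s : ℝ} (hs : 0 ≤ s) {A : Set Ω}
    (hA : MeasurableSet[ℱ s] A) :
    (P.restrict A).map (incrPath X s) = P A • P.map (incrPath X 0) := by
  have := hX.isProb
  have : IsFiniteMeasure (P A • P.map (incrPath X 0)) :=
    Measure.smul_finite _ (measure_ne_top _ _)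
  refine IsProjectiveLimit.unique
    (P := fun I => ((P.restrict A).map (incrPath X s)).map I.restrict) (fun _ => rfl) fun I => ?_
  beta_reduce
  set N : ℕ := ∏ q ∈ I, q.den with hN
  have hN0 : N ≠ 0 := Finset.prod_ne_zero_iff.2 fun q _ => q.den_ne_zero
  have hk : ∀ q ∈ I, ∃ k : ℕ, (q : ℝ) = k * (1 / N : ℝ) := by
    intro q hq
    obtain ⟨d, hd⟩ := Finset.dvd_prod_of_mem (fun q : ℚ≥0 => q.den) hq
    have hqd : (q.den : ℝ) ≠ 0 := by exact_mod_cast q.den_ne_zero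
    have hd' : (N : ℝ) = q.den * d := by rw [hN]; exact_mod_cast hd
    have hd0 : (d : ℝ) ≠ 0 := by
      intro h; rw [h, mul_zero] at hd'; exact hN0 (by exact_mod_cast hd')
    refine ⟨q.num * d, ?_⟩
    rw [hd', NNRat.cast_def]
    push_cast
    field_simp
  choose! k hk using hk
  set n : ℕ := I.sup k
  set R : (ℕ → ℝ) → (I → ℝ) := fun v q => v (k q)
  have mR : Measurable R := measurable_pi_lambda _ fun q => measurable_pi_apply _
  have hcomp : ∀ s, I.restrict ∘ incrPath X s = R ∘ gridPath X (1 / N : ℝ) s n := by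
    intro s
    funext ω ⟨q, hq⟩
    simp only [Function.comp, Finset.restrict, incrPath, R, gridPath]
    rw [min_eq_left (Finset.le_sup hq), ← hk q hq]
  have mg : ∀ s, 0 ≤ s → Measurable (gridPath X (1 / N : ℝ) s n) := fun s hs =>
    (hX.measurable_gridPath (by positivity) hs n).mono (ℱ.le _) le_rfl
  rw [Measure.map_smul, Measure.map_map (by fun_prop) (hX.measurable_incrPath le_rfl),
    Measure.map_map (by fun_prop) (hX.measurable_incrPath hs), hcomp, hcomp,
    ← Measure.map_map mR (mg s hs), ← Measure.map_map mR (mg 0 le_rfl),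
    hX.map_gridPath (by positivity) n hs hA, Measure.map_smul]

/-- The Markov property at a deterministic time. -/
theorem IsLevy.lintegral_incrPath (hX : IsLevy P ℱ X) {s : ℝ} (hs : 0 ≤ s) {A : Set Ω}
    (hA : MeasurableSet[ℱ s] A) {Z : Ω → ℝ} (hZ : Measurable[ℱ s] Z)
    {Ψ : ℝ × (ℚ≥0 → ℝ) → ℝ≥0∞} (hΨ : Measurable Ψ) :
    ∫⁻ ω in A, Ψ (Z ω, incrPath X s ω) ∂P =
      ∫⁻ ω in A, ∫⁻ ω', Ψ (Z ω, incrPath X 0 ω') ∂P ∂P := by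
  have := hX.isProb
  have mZ : Measurable Z := hZ.mono (ℱ.le _) le_rfl
  have mY := hX.measurable_incrPath hs
  have mY0 := hX.measurable_incrPath le_rfl
  have : IsProbabilityMeasure (P.map (incrPath X 0)) :=
    Measure.isProbabilityMeasure_map mY0.aemeasurable
  have hprod : (P.restrict A).map (fun ω => (Z ω, incrPath X s ω)) =
      ((P.restrict A).map Z).prod (P.map (incrPath X 0)) := by
    symm
    refine Measure.prod_eq fun B C hB hC => ?_
    have hAB : MeasurableSet[ℱ s] (Z ⁻¹' B ∩ A) := (hZ hB).inter hA
    have h1 := congrArg (fun μ => μ C) (hX.map_incrPath hs hAB)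
    simp only [Measure.smul_apply, smul_eq_mul] at h1
    rw [Measure.map_apply mY hC, Measure.restrict_apply (mY hC)] at h1
    rw [Measure.map_apply (mZ.prodMk mY) (hB.prod hC), Measure.map_apply mZ hB,
      Measure.restrict_apply (mZ.prodMk mY (hB.prod hC)), Measure.restrict_apply (mZ hB), ← h1]
    congr 1
    ext ω
    simp only [mem_inter_iff, mem_preimage, mem_prod]
    tauto
  rw [← lintegral_map (f := Ψ) hΨ (mZ.prodMk mY), hprod, lintegral_prod _ hΨ.aemeasurable,
    lintegral_map hΨ.lintegral_prod_right' mZ]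
  refine lintegral_congr fun ω => ?_
  rw [lintegral_map (by fun_prop) mY0]

end Law

section Hitting

variable {X : ℝ → Ω → ℝ} {y x : ℝ} {ω : Ω}

theorem hitBelowE_le (q : ℚ≥0) (hq : x + X q ω < y) : hitBelowE X y x ω ≤ ENNReal.ofReal q := by
  have hex : ∃ t : ℝ, 0 ≤ t ∧ x + X t ω < y := ⟨q, by positivity, hq⟩
  rw [hitBelowE, if_pos hex]
  exact ENNReal.ofReal_le_ofReal (csInf_le ⟨0, fun _ h => h.1⟩ ⟨by positivity, hq⟩)

theorem exists_nnrat_of_hitBelowE_lt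
    (hr : ∀ t : ℝ, 0 ≤ t → ContinuousWithinAt (fun s => X s ω) (Ici t) t) {b : ℝ≥0∞}
    (hb : hitBelowE X y x ω < b) : ∃ q : ℚ≥0, ENNReal.ofReal q < b ∧ x + X q ω < y := by
  by_cases hex : ∃ t : ℝ, 0 ≤ t ∧ x + X t ω < y
  · rw [hitBelowE, if_pos hex] at hb
    obtain ⟨c, hc1, hc2⟩ := ENNReal.lt_iff_exists_nnreal_btwn.1 hb
    rw [ENNReal.ofReal_lt_iff_lt_toReal (Real.sInf_nonneg fun _ h => h.1) ENNReal.coe_ne_top,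
      ENNReal.coe_toReal] at hc1
    obtain ⟨s, ⟨hs0, hs⟩, hsc⟩ := exists_lt_of_csInf_lt hex hc1
    obtain ⟨q, -, hq, hqX⟩ := exists_nnrat_lt_of_lt (a := y - x) hs0 (hr s hs0) (by linarith)
      (sub_pos.2 hsc)
    refine ⟨q, lt_of_le_of_lt ?_ hc2, by linarith⟩
    rw [← ENNReal.ofReal_coe_nnreal]
    exact ENNReal.ofReal_le_ofReal (by linarith)
  · rw [hitBelowE, if_neg hex] at hb
    exact absurd hb not_top_lt

theorem add_apply_hitBelowE_le
    (hr : ∀ t : ℝ, 0 ≤ t → ContinuousWithinAt (fun s => X s ω) (Ici t) t)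
    (hfin : hitBelowE X y x ω ≠ ∞) : x + X (hitBelowE X y x ω).toReal ω ≤ y := by
  by_contra! h
  set t := (hitBelowE X y x ω).toReal with ht
  have ht0 : 0 ≤ t := ENNReal.toReal_nonneg
  have h1 : ∀ᶠ u in nhdsWithin t (Ici t), y - x < X u ω :=
    (hr t ht0).eventually_const_lt (by linarith)
  obtain ⟨u, hu, hsub⟩ := (mem_nhdsGE_iff_exists_Ico_subset (a := t)).1 h1
  have hlt : hitBelowE X y x ω < ENNReal.ofReal u := by
    rw [ENNReal.lt_ofReal_iff_toReal_lt hfin]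
    exact hu
  obtain ⟨q, hq, hqX⟩ := exists_nnrat_of_hitBelowE_lt hr hlt
  have h2 : t ≤ q := ENNReal.toReal_le_of_le_ofReal (by positivity) (hitBelowE_le q hqX)
  have h3 : (q : ℝ) < u := ENNReal.ofReal_lt_ofReal_iff_of_nonneg (by positivity) |>.1 hq
  have h4 : y - x < X q ω := hsub ⟨h2, h3⟩
  linarith

theorem IsLevy.isStopTime_hitBelowE [m0 : MeasurableSpace Ω] {P : Measure Ω}
    {ℱ : Filtration ℝ m0} (hX : IsLevy P ℱ X) (y x : ℝ) : IsStopTime ℱ (hitBelowE X y x) := by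
  intro t ht
  rw [hX.filtRightCont t]
  simp only [MeasurableSpace.measurableSet_iInf]
  intro s hs
  have hset : {ω | hitBelowE X y x ω ≤ ENNReal.ofReal t} =
      ⋂ n : ℕ, ⋃ q : ℚ≥0, {ω | ENNReal.ofReal q < ENNReal.ofReal (min s (t + 1 / (n + 1))) ∧
        x + X q ω < y} := by
    ext ω
    simp only [mem_ofPred_eq, mem_iInter, mem_iUnion]
    constructor
    · intro h n
      refine exists_nnrat_of_hitBelowE_lt (hX.rightCont ω) (h.trans_lt ?_)
      have hn : (0 : ℝ) < 1 / (n + 1) := by positivity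
      exact (ENNReal.ofReal_lt_ofReal_iff_of_nonneg ht).2 (lt_min hs (by linarith))
    · intro h
      have hlim : Tendsto (fun n : ℕ => ENNReal.ofReal (t + 1 / ((n : ℝ) + 1))) atTop
          (nhds (ENNReal.ofReal (t + 0))) :=
        ENNReal.tendsto_ofReal (tendsto_const_nhds.add tendsto_one_div_add_atTop_nhds_zero_nat)
      rw [add_zero] at hlim
      refine ge_of_tendsto' hlim fun n => ?_
      obtain ⟨q, hq, hqX⟩ := h n
      exact (hitBelowE_le q hqX).trans
        (hq.le.trans (ENNReal.ofReal_le_ofReal (min_le_right _ _)))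
  rw [hset]
  refine MeasurableSet.iInter fun n => MeasurableSet.iUnion fun q => ?_
  by_cases hq : ENNReal.ofReal q < ENNReal.ofReal (min s (t + 1 / (n + 1)))
  · have hqs : (q : ℝ) ≤ s := by
      by_contra! hc
      exact absurd hq (not_lt.2 (ENNReal.ofReal_le_ofReal ((min_le_left _ _).trans hc.le)))
    have mq : Measurable[ℱ s] (X q) :=
      (hX.adapted q (by positivity)).measurable.mono (ℱ.mono hqs) le_rfl
    have : MeasurableSet[ℱ s] {ω | X q ω < y - x} := mq measurableSet_Iio
    have heq : {ω | ENNReal.ofReal q < ENNReal.ofReal (min s (t + 1 / (n + 1))) ∧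
        x + X q ω < y} = {ω | X q ω < y - x} := by
      ext ω
      exact ⟨fun h => lt_sub_iff_add_lt'.2 h.2, fun h => ⟨hq, lt_sub_iff_add_lt'.1 h⟩⟩
    rwa [heq]
  · simp only [hq, false_and, ofPred_false]
    exact @MeasurableSet.empty _ (ℱ s)

end Hitting

section KillLaw

/-- The law of `e_r`: exponential of rate `r` if `r > 0`, and a point mass at `∞` otherwise. -/
def killLaw (r : ℝ) : Measure ℝ≥0∞ :=
  if 0 < r then (expMeasure r).map ENNReal.ofReal else Measure.dirac ∞

theorem isProbabilityMeasure_killLaw (r : ℝ) : IsProbabilityMeasure (killLaw r) := by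
  unfold killLaw
  split_ifs with h
  · have := isProbabilityMeasure_expMeasure h
    exact Measure.isProbabilityMeasure_map ENNReal.measurable_ofReal.aemeasurable
  · infer_instance

theorem lintegral_killLaw {r : ℝ} (hr : 0 < r) {g : ℝ≥0∞ → ℝ≥0∞} (hg : Measurable g) :
    ∫⁻ t, g t ∂killLaw r =
      ∫⁻ t in Ioi 0, ENNReal.ofReal (r * Real.exp (-(r * t))) * g (ENNReal.ofReal t) := by
  have hexp : expMeasure r = volume.withDensity (exponentialPDF r) := rfl
  have hmeas : Measurable (exponentialPDF r) := (measurable_exponentialPDFReal r).ennreal_ofReal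
  rw [killLaw, if_pos hr, lintegral_map hg ENNReal.measurable_ofReal, hexp,
    lintegral_withDensity_eq_lintegral_mul _ hmeas
      (g := fun t => g (ENNReal.ofReal t)) (hg.comp ENNReal.measurable_ofReal),
    restrict_Ioi_eq_restrict_Ici, ← lintegral_indicator measurableSet_Ici]
  refine lintegral_congr fun t => ?_
  rw [Pi.mul_apply, exponentialPDF_eq, Set.indicator_apply]
  by_cases h : 0 ≤ t <;> simp [h]

/-- The lack of memory of `killLaw r`. -/
theorem setLIntegral_killLaw {r s : ℝ} (hr : 0 ≤ r) (hs : 0 ≤ s) {g : ℝ≥0∞ → ℝ≥0∞}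
    (hg : Measurable g) :
    ∫⁻ t in Ioi (ENNReal.ofReal s), g t ∂killLaw r =
      ENNReal.ofReal (Real.exp (-(r * s))) * ∫⁻ t, g (ENNReal.ofReal s + t) ∂killLaw r := by
  rcases hr.eq_or_lt with rfl | hr
  · rw [killLaw, if_neg (lt_irrefl _), ← lintegral_indicator measurableSet_Ioi,
      lintegral_dirac, lintegral_dirac]
    simp
  · rw [← lintegral_indicator measurableSet_Ioi,
      lintegral_killLaw hr (hg.indicator measurableSet_Ioi),
      lintegral_killLaw hr (g := fun t => g (ENNReal.ofReal s + t))
        (hg.comp (measurable_const_add _)),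
      ← lintegral_indicator measurableSet_Ioi, ← lintegral_indicator measurableSet_Ioi,
      ← lintegral_const_mul', ← lintegral_add_right_eq_self _ s]
    · refine lintegral_congr fun u => ?_
      rcases le_or_gt u 0 with hu | hu
      · have h1 : ¬ (ENNReal.ofReal s < ENNReal.ofReal (u + s)) :=
          not_lt.2 (ENNReal.ofReal_le_ofReal (by linarith))
        simp [Set.indicator_apply, h1, hu.not_gt]
      · have h1 : ENNReal.ofReal s < ENNReal.ofReal (u + s) :=
          (ENNReal.ofReal_lt_ofReal_iff_of_nonneg hs).2 (by linarith)
        have h2 : 0 < u + s := by linarith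
        simp only [Set.indicator_apply, mem_Ioi, h1, hu, h2, if_true]
        rw [← mul_assoc, ← ENNReal.ofReal_mul (Real.exp_pos _).le, add_comm u s,
          ENNReal.ofReal_add hs hu.le]
        congr 2
        rw [mul_left_comm, ← Real.exp_add]
        ring_nf
    · exact ENNReal.ofReal_ne_top

end KillLaw

section Horizon

variable {X : ℝ → Ω → ℝ}

/-- The infimum of the process up to a possibly infinite time. -/
def infTo (X : ℝ → Ω → ℝ) (t : ℝ≥0∞) (ω : Ω) : ℝ :=
  sInf ((fun s => X s ω) '' {s : ℝ | 0 ≤ s ∧ ENNReal.ofReal s ≤ t})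

theorem infTo_top (X : ℝ → Ω → ℝ) : infTo X ∞ = infAll X := by
  funext ω
  simp only [infTo, infAll, le_top, and_true]
  rfl

theorem setOf_ofReal_le {t : ℝ} (ht : 0 ≤ t) :
    {s : ℝ | 0 ≤ s ∧ ENNReal.ofReal s ≤ ENNReal.ofReal t} = Icc 0 t := by
  ext s
  simp [ENNReal.ofReal_le_ofReal_iff ht]

theorem infTo_ofReal (X : ℝ → Ω → ℝ) {t : ℝ} (ht : 0 ≤ t) :
    infTo X (ENNReal.ofReal t) = runInf X t := by
  funext ω
  rw [infTo, setOf_ofReal_le ht, runInf]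

theorem exists_lt_of_infTo_lt {ω : Ω} {t : ℝ≥0∞} {a : ℝ} (h : infTo X t ω < a) :
    ∃ s : ℝ, 0 ≤ s ∧ ENNReal.ofReal s ≤ t ∧ X s ω < a := by
  obtain ⟨_, ⟨s, ⟨hs0, hst⟩, rfl⟩, hs⟩ := exists_lt_of_csInf_lt (Set.Nonempty.image _
    (s := {s : ℝ | 0 ≤ s ∧ ENNReal.ofReal s ≤ t}) ⟨0, le_rfl, by simp⟩) h
  exact ⟨s, hs0, hst, hs⟩

variable [m0 : MeasurableSpace Ω] {P : Measure Ω} {ℱ : Filtration ℝ m0}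

theorem IsLevy.infTo_eq_iInf (hX : IsLevy P ℱ X) {ω : Ω} {t : ℝ≥0∞}
    (hb : BddBelow ((fun s => X s ω) '' {s : ℝ | 0 ≤ s ∧ ENNReal.ofReal s ≤ t})) :
    infTo X t ω = ⨅ q : ℚ≥0, X (min (ENNReal.ofReal q) t).toReal ω := by
  have hmem : ∀ q : ℚ≥0, X (min (ENNReal.ofReal q) t).toReal ω ∈
      (fun s => X s ω) '' {s : ℝ | 0 ≤ s ∧ ENNReal.ofReal s ≤ t} := by
    intro q
    refine ⟨_, ⟨ENNReal.toReal_nonneg, ?_⟩, rfl⟩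
    rw [ENNReal.ofReal_toReal (ne_top_of_le_ne_top ENNReal.ofReal_ne_top (min_le_left _ _))]
    exact min_le_right _ _
  have hb' : BddBelow (range fun q : ℚ≥0 => X (min (ENNReal.ofReal q) t).toReal ω) :=
    hb.mono (range_subset_iff.2 hmem)
  refine le_antisymm (le_ciInf fun q => csInf_le hb (hmem q)) ?_
  refine le_csInf (Set.Nonempty.image _ ⟨0, le_rfl, by simp⟩) ?_
  rintro _ ⟨s, ⟨hs0, hst⟩, rfl⟩
  refine le_of_forall_gt fun a ha => ?_
  have ha' : X s ω < a := ha
  obtain ⟨q, hq⟩ : ∃ q : ℚ≥0, X (min (ENNReal.ofReal q) t).toReal ω < a := by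
    rcases hst.eq_or_lt with h | h
    · obtain ⟨q, hq, -⟩ := exists_nnrat_lt_of_lt hs0 (hX.rightCont ω s hs0) ha' one_pos
      refine ⟨q, ?_⟩
      rwa [← h, min_eq_right (ENNReal.ofReal_le_ofReal hq), ENNReal.toReal_ofReal hs0]
    · obtain ⟨c, hc1, hc2⟩ := ENNReal.lt_iff_exists_nnreal_btwn.1 h
      rw [← ENNReal.ofReal_coe_nnreal, ENNReal.ofReal_lt_ofReal_iff_of_nonneg hs0] at hc1
      rw [← ENNReal.ofReal_coe_nnreal] at hc2
      obtain ⟨q, -, hq, hqX⟩ := exists_nnrat_lt_of_lt hs0 (hX.rightCont ω s hs0) ha'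
        (sub_pos.2 hc1)
      refine ⟨q, ?_⟩
      rwa [min_eq_left ((ENNReal.ofReal_le_ofReal (by linarith)).trans hc2.le),
        ENNReal.toReal_ofReal (by positivity)]
  exact (ciInf_le hb' q).trans_lt hq

theorem IsLevy.aemeasurable_infTo (hX : IsLevy P ℱ X) {t : ℝ≥0∞}
    (hb : ∀ᵐ ω ∂P, BddBelow ((fun s => X s ω) '' {s : ℝ | 0 ≤ s ∧ ENNReal.ofReal s ≤ t})) :
    AEMeasurable (infTo X t) P :=
  ⟨_, Measurable.iInf fun _ : ℚ≥0 => hX.measurable ENNReal.toReal_nonneg,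
    hb.mono fun _ h => hX.infTo_eq_iInf h⟩

theorem IsLevy.bddBelow_ofReal (hX : IsLevy P ℱ X) {t : ℝ} (ht : 0 ≤ t) (ω : Ω) :
    BddBelow ((fun s => X s ω) '' {s : ℝ | 0 ≤ s ∧ ENNReal.ofReal s ≤ ENNReal.ofReal t}) := by
  rw [setOf_ofReal_le ht]
  exact bddBelow_image_Icc (hX.rightCont ω) (hX.leftLim ω) t

theorem IsLevy.bddBelow_top (hX : IsLevy P ℱ X)
    (h : P {ω | Tendsto (fun t => X t ω) atTop atTop} = 1) :
    ∀ᵐ ω ∂P, BddBelow ((fun s => X s ω) '' {s : ℝ | 0 ≤ s ∧ ENNReal.ofReal s ≤ ∞}) := by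
  have := hX.isProb
  have hset : {ω | Tendsto (fun t => X t ω) atTop atTop} =
      ⋂ n : ℕ, ⋃ k : ℕ, ⋂ q : ℚ≥0, {ω | (k : ℝ) ≤ q → (n : ℝ) ≤ X q ω} := by
    ext ω
    simp only [mem_ofPred_eq, mem_iInter, mem_iUnion]
    constructor
    · intro ht n
      obtain ⟨T, hT⟩ := eventually_atTop.1 (ht.eventually_ge_atTop (n : ℝ))
      obtain ⟨k, hk⟩ := exists_nat_ge T
      exact ⟨k, fun q hq => hT _ (hk.trans hq)⟩
    · intro ht
      refine tendsto_atTop.2 fun b => ?_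
      obtain ⟨n, hn⟩ := exists_nat_ge b
      obtain ⟨k, hk⟩ := ht n
      filter_upwards [eventually_ge_atTop (k : ℝ)] with s hs
      have hs0 : (0 : ℝ) ≤ s := (Nat.cast_nonneg k).trans hs
      by_contra! hlt
      obtain ⟨q, hq, -, hqX⟩ := exists_nnrat_lt_of_lt hs0 (hX.rightCont ω s hs0)
        (hlt.trans_le hn) one_pos
      exact absurd (hk q (hs.trans hq)) (not_le.2 hqX)
  have hm : MeasurableSet {ω | Tendsto (fun t => X t ω) atTop atTop} := by
    rw [hset]
    refine MeasurableSet.iInter fun n => MeasurableSet.iUnion fun k => MeasurableSet.iInter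
      fun q => ?_
    by_cases hq : (k : ℝ) ≤ q
    · simp only [hq, true_imp_iff]
      exact hX.measurable (t := q) (by positivity) measurableSet_Ici
    · simp [hq]
  have hae : ∀ᵐ ω ∂P, Tendsto (fun t => X t ω) atTop atTop :=
    (mem_ae_iff_prob_eq_one hm).2 h
  filter_upwards [hae] with ω hω
  obtain ⟨T, hT⟩ := eventually_atTop.1 (hω.eventually_ge_atTop 0)
  obtain ⟨b, hb⟩ := bddBelow_image_Icc (hX.rightCont ω) (hX.leftLim ω) T
  refine ⟨min b 0, ?_⟩
  rintro _ ⟨s, ⟨hs, -⟩, rfl⟩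
  rcases le_total s T with h1 | h1
  · exact (min_le_left _ _).trans (hb ⟨s, ⟨hs, h1⟩, rfl⟩)
  · exact (min_le_right _ _).trans (hT s h1)

/-- Almost surely the process is bounded below up to almost every killing time. -/
theorem IsLevy.bddBelow_killLaw (hX : IsLevy P ℱ X) {r : ℝ}
    (hr : 0 < r ∨ (r = 0 ∧ P {ω | Tendsto (fun t => X t ω) atTop atTop} = 1)) :
    ∀ᵐ t ∂killLaw r, ∀ᵐ ω ∂P,
      BddBelow ((fun s => X s ω) '' {s : ℝ | 0 ≤ s ∧ ENNReal.ofReal s ≤ t}) := by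
  rcases hr with hr | ⟨rfl, h⟩
  · rw [killLaw, if_pos hr]
    have hne : ∀ᵐ t ∂(expMeasure r).map ENNReal.ofReal, t ≠ ∞ :=
      (ae_map_iff ENNReal.measurable_ofReal.aemeasurable (measurableSet_singleton _).compl).2
        (Eventually.of_forall fun _ => ENNReal.ofReal_ne_top)
    filter_upwards [hne] with t ht
    refine Eventually.of_forall fun ω => ?_
    rw [← ENNReal.ofReal_toReal ht]
    exact hX.bddBelow_ofReal ENNReal.toReal_nonneg ω
  · rw [killLaw, if_neg (lt_irrefl _), ae_dirac_eq]
    exact hX.bddBelow_top h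

theorem IsLevy.infTo_nonpos (hX : IsLevy P ℱ X) {t : ℝ≥0∞}
    (hb : ∀ᵐ ω ∂P, BddBelow ((fun s => X s ω) '' {s : ℝ | 0 ≤ s ∧ ENNReal.ofReal s ≤ t})) :
    ∀ᵐ ω ∂P, infTo X t ω ≤ 0 := by
  filter_upwards [hb, hX.zero] with ω h h0
  exact h0 ▸ csInf_le h ⟨0, ⟨le_rfl, by simp⟩, rfl⟩

theorem IsLevy.measurable_lintegral_infTo (hX : IsLevy P ℱ X) :
    Measurable fun t => ∫⁻ ω, ENNReal.ofReal (Real.exp (infTo X t ω)) ∂P := by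
  refine ENNReal.measurable_of_measurable_nnreal (Antitone.measurable fun t u htu => ?_)
  refine lintegral_mono fun ω => ENNReal.ofReal_le_ofReal (Real.exp_le_exp.2 ?_)
  refine csInf_le_csInf ?_ (Set.Nonempty.image _ ⟨0, le_rfl, by simp⟩) (image_mono ?_)
  · rw [← ENNReal.ofReal_coe_nnreal]
    exact hX.bddBelow_ofReal u.2 ω
  · exact fun s hs => ⟨hs.1, hs.2.trans (by exact_mod_cast htu)⟩

theorem IsLevy.lintegral_exp_infTo_pos (hX : IsLevy P ℱ X) {t : ℝ≥0∞}
    (hb : ∀ᵐ ω ∂P, BddBelow ((fun s => X s ω) '' {s : ℝ | 0 ≤ s ∧ ENNReal.ofReal s ≤ t})) :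
    (∫⁻ ω, ENNReal.ofReal (Real.exp (infTo X t ω)) ∂P) ≠ 0 := by
  have := hX.isProb
  intro h
  rw [lintegral_eq_zero_iff' (f := fun ω => ENNReal.ofReal (Real.exp (infTo X t ω)))
    (Real.measurable_exp.comp_aemeasurable (hX.aemeasurable_infTo hb)).ennreal_ofReal] at h
  obtain ⟨ω, hω⟩ := h.exists
  simp only [Pi.zero_apply, ENNReal.ofReal_eq_zero] at hω
  exact absurd hω (not_le.2 (Real.exp_pos _))

theorem IsLevy.lintegral_exp_infTo_le (hX : IsLevy P ℱ X) {t : ℝ≥0∞}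
    (hb : ∀ᵐ ω ∂P, BddBelow ((fun s => X s ω) '' {s : ℝ | 0 ≤ s ∧ ENNReal.ofReal s ≤ t})) :
    (∫⁻ ω, ENNReal.ofReal (Real.exp (infTo X t ω)) ∂P) ≤ 1 := by
  have := hX.isProb
  refine (lintegral_mono_ae (g := fun _ => 1) ?_).trans (by simp)
  filter_upwards [hX.infTo_nonpos hb] with ω hω
  simpa using hω

theorem IsLevy.integral_exp_infTo (hX : IsLevy P ℱ X) {t : ℝ≥0∞}
    (hb : ∀ᵐ ω ∂P, BddBelow ((fun s => X s ω) '' {s : ℝ | 0 ≤ s ∧ ENNReal.ofReal s ≤ t})) :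
    ENNReal.ofReal (∫ ω, Real.exp (infTo X t ω) ∂P) =
      ∫⁻ ω, ENNReal.ofReal (Real.exp (infTo X t ω)) ∂P := by
  rw [integral_eq_lintegral_of_nonneg_ae (Eventually.of_forall fun _ => (Real.exp_pos _).le)
    (Real.measurable_exp.comp_aemeasurable (hX.aemeasurable_infTo hb)).aestronglyMeasurable,
    ENNReal.ofReal_toReal]
  exact ((hX.lintegral_exp_infTo_le hb).trans_lt ENNReal.one_lt_top).ne

theorem IsLevy.ofReal_mInf (hX : IsLevy P ℱ X) {r : ℝ}
    (hr : 0 < r ∨ (r = 0 ∧ P {ω | Tendsto (fun t => X t ω) atTop atTop} = 1)) :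
    ENNReal.ofReal (mInf P X r) =
      ∫⁻ t, ∫⁻ ω, ENNReal.ofReal (Real.exp (infTo X t ω)) ∂P ∂killLaw r := by
  have hbdd := hX.bddBelow_killLaw hr
  have hle : (∫⁻ t, ∫⁻ ω, ENNReal.ofReal (Real.exp (infTo X t ω)) ∂P ∂killLaw r) ≤ 1 := by
    have := isProbabilityMeasure_killLaw r
    refine (lintegral_mono_ae (g := fun _ => 1) ?_).trans (by simp)
    filter_upwards [hbdd] with t ht using hX.lintegral_exp_infTo_le ht
  rcases hr with hr | ⟨rfl, h⟩
  · have hinner : ∀ t : ℝ, 0 ≤ t → ENNReal.ofReal (∫ ω, Real.exp (runInf X t ω) ∂P) =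
        ∫⁻ ω, ENNReal.ofReal (Real.exp (infTo X (ENNReal.ofReal t) ω)) ∂P := by
      intro t ht
      rw [← infTo_ofReal X ht]
      exact hX.integral_exp_infTo (Eventually.of_forall (hX.bddBelow_ofReal ht))
    rw [lintegral_killLaw hr hX.measurable_lintegral_infTo] at hle ⊢
    have hcongr : ∀ t ∈ Ioi (0 : ℝ),
        ENNReal.ofReal (r * Real.exp (-(r * t)) * ∫ ω, Real.exp (runInf X t ω) ∂P) =
        ENNReal.ofReal (r * Real.exp (-(r * t))) *
          ∫⁻ ω, ENNReal.ofReal (Real.exp (infTo X (ENNReal.ofReal t) ω)) ∂P := by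
      intro t ht
      rw [ENNReal.ofReal_mul (by positivity), hinner t (le_of_lt ht)]
    rw [mInf, if_pos hr, integral_eq_lintegral_of_nonneg_ae, setLIntegral_congr_fun
      measurableSet_Ioi hcongr, ENNReal.ofReal_toReal (hle.trans_lt ENNReal.one_lt_top).ne]
    · refine Eventually.of_forall fun t => ?_
      exact mul_nonneg (by positivity) (integral_nonneg fun ω => (Real.exp_pos _).le)
    · refine AEMeasurable.aestronglyMeasurable (AEMeasurable.mul (by fun_prop) ?_)
      refine ⟨fun t => (∫⁻ ω, ENNReal.ofReal (Real.exp (infTo X (ENNReal.ofReal t) ω)) ∂P).toReal,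
        (hX.measurable_lintegral_infTo.comp ENNReal.measurable_ofReal).ennreal_toReal, ?_⟩
      filter_upwards [ae_restrict_mem measurableSet_Ioi] with t ht
      rw [← hinner t (le_of_lt ht), ENNReal.toReal_ofReal
        (integral_nonneg fun ω => (Real.exp_pos _).le)]
  · rw [killLaw, if_neg (lt_irrefl _), lintegral_dirac, mInf, if_neg (lt_irrefl _),
      ← infTo_top]
    exact hX.integral_exp_infTo (hX.bddBelow_top h)

theorem IsLevy.mInf_pos (hX : IsLevy P ℱ X) {r : ℝ}
    (hr : 0 < r ∨ (r = 0 ∧ P {ω | Tendsto (fun t => X t ω) atTop atTop} = 1)) :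
    0 < mInf P X r := by
  have := isProbabilityMeasure_killLaw r
  rw [← ENNReal.ofReal_pos, hX.ofReal_mInf hr, pos_iff_ne_zero, Ne,
    lintegral_eq_zero_iff hX.measurable_lintegral_infTo]
  intro h
  obtain ⟨t, ht, hb⟩ := (h.and (hX.bddBelow_killLaw hr)).exists
  exact hX.lintegral_exp_infTo_pos hb ht

end Horizon

section Value

/-- The discounted running maximum of `φ` along a path started at `p.1` with increments `p.2`. -/
def killedSup (r : ℝ) (φ : ℝ → ℝ≥0∞) (p : ℝ × (ℚ≥0 → ℝ)) : ℝ≥0∞ :=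
  ∫⁻ t, ⨆ q : ℚ≥0, (if ENNReal.ofReal q < t then φ (p.1 + p.2 q) else 0) ∂killLaw r

/-- The supremum of `φ (x + X)` over rational times between `s` and `t`. -/
def tailSup (X : ℝ → Ω → ℝ) (φ : ℝ → ℝ≥0∞) (x : ℝ) (s : ℚ≥0) (ω : Ω) (t : ℝ≥0∞) : ℝ≥0∞ :=
  ⨆ q : ℚ≥0, if s ≤ q ∧ ENNReal.ofReal q < t then φ (x + X q ω) else 0

theorem measurable_iSup_before {φ : ℝ → ℝ≥0∞} (hφ : Measurable φ) :
    Measurable fun p : (ℝ × (ℚ≥0 → ℝ)) × ℝ≥0∞ =>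
      ⨆ q : ℚ≥0, (if ENNReal.ofReal q < p.2 then φ (p.1.1 + p.1.2 q) else 0) :=
  Measurable.iSup fun q => Measurable.ite (measurableSet_lt measurable_const measurable_snd)
    (hφ.comp (by fun_prop)) measurable_const

theorem measurable_killedSup (r : ℝ) {φ : ℝ → ℝ≥0∞} (hφ : Measurable φ) :
    Measurable (killedSup r φ) := by
  have := isProbabilityMeasure_killLaw r
  exact (measurable_iSup_before hφ).lintegral_prod_right'

theorem measurable_tailSup_right (X : ℝ → Ω → ℝ) (φ : ℝ → ℝ≥0∞) (x : ℝ) (s : ℚ≥0) (ω : Ω) :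
    Measurable (tailSup X φ x s ω) := by
  refine Measurable.iSup fun q => Measurable.ite ?_ measurable_const measurable_const
  exact (MeasurableSet.const _).inter measurableSet_Ioi

theorem tailSup_anti (X : ℝ → Ω → ℝ) (φ : ℝ → ℝ≥0∞) (x : ℝ) (s : ℚ≥0) (ω : Ω) (t : ℝ≥0∞) :
    tailSup X φ x s ω t ≤ tailSup X φ x 0 ω t := by
  refine iSup_mono fun q => ?_
  split_ifs with h1 h2 <;> simp_all

theorem le_tailSup {X : ℝ → Ω → ℝ} {φ : ℝ → ℝ≥0∞} {x : ℝ} {s : ℚ≥0} {ω : Ω} {t : ℝ≥0∞}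
    {q : ℚ≥0} (hs : s ≤ q) (ht : ENNReal.ofReal q < t) :
    φ (x + X q ω) ≤ tailSup X φ x s ω t := by
  refine le_trans ?_ (le_iSup _ q)
  rw [if_pos ⟨hs, ht⟩]

theorem exp_mul_killedSup {r : ℝ} (hr : 0 ≤ r) (X : ℝ → Ω → ℝ) (φ : ℝ → ℝ≥0∞) (x : ℝ)
    (s : ℚ≥0) (ω : Ω) :
    ENNReal.ofReal (Real.exp (-(r * s))) * killedSup r φ (x + X s ω, incrPath X s ω) =
      ∫⁻ t, tailSup X φ x s ω t ∂killLaw r := by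
  have hvanish : ∀ t ∉ Ioi (ENNReal.ofReal s), tailSup X φ x s ω t = 0 := by
    intro t ht
    refine le_antisymm (iSup_le fun q => ?_) zero_le
    rw [if_neg]
    rintro ⟨h1, h2⟩
    have h3 : (s : ℝ) ≤ q := by exact_mod_cast h1
    exact ht ((ENNReal.ofReal_le_ofReal h3).trans_lt h2)
  have hres : ∫⁻ t, tailSup X φ x s ω t ∂killLaw r =
      ∫⁻ t in Ioi (ENNReal.ofReal s), tailSup X φ x s ω t ∂killLaw r := by
    rw [← lintegral_indicator measurableSet_Ioi]
    refine lintegral_congr fun t => ?_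
    rw [Set.indicator_apply]
    split_ifs with h
    · rfl
    · exact hvanish t h
  rw [hres, setLIntegral_killLaw hr (by positivity) (measurable_tailSup_right X φ x s ω),
    killedSup]
  congr 1
  refine lintegral_congr fun t => le_antisymm (iSup_le fun q => ?_) (iSup_le fun q => ?_)
  · split_ifs with h
    · have h1 : x + X s ω + incrPath X s ω q = x + X ((s + q : ℚ≥0) : ℝ) ω := by
        rw [incrPath]; push_cast; ring
      rw [h1]
      refine le_tailSup le_self_add ?_
      push_cast
      rw [ENNReal.ofReal_add (by positivity) (by positivity)]
      exact ENNReal.add_lt_add_left ENNReal.ofReal_ne_top h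
    · exact zero_le
  · split_ifs with h
    · obtain ⟨u, rfl⟩ := exists_add_of_le h.1
      have h1 : x + X s ω + incrPath X s ω u = x + X ((s + u : ℚ≥0) : ℝ) ω := by
        rw [incrPath]; push_cast; ring
      have h2 := h.2
      push_cast at h2
      rw [ENNReal.ofReal_add (by positivity) (by positivity)] at h2
      rw [← h1]
      refine le_trans ?_ (le_iSup _ u)
      rw [if_pos (lt_of_add_lt_add_left h2)]
    · exact zero_le

variable [m0 : MeasurableSpace Ω] {P : Measure Ω} {ℱ : Filtration ℝ m0} {X : ℝ → Ω → ℝ}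

/-- The expected running maximum of `φ (z + X)` up to the killing time. -/
def killedValue (P : Measure Ω) (X : ℝ → Ω → ℝ) (r : ℝ) (φ : ℝ → ℝ≥0∞) (z : ℝ) : ℝ≥0∞ :=
  ∫⁻ ω, killedSup r φ (z, incrPath X 0 ω) ∂P

theorem IsLevy.setLIntegral_tailSup (hX : IsLevy P ℱ X) {r : ℝ} (hr : 0 ≤ r) {φ : ℝ → ℝ≥0∞}
    (hφ : Measurable φ) (x : ℝ) (s : ℚ≥0) {A : Set Ω} (hA : MeasurableSet[ℱ s] A) :
    ∫⁻ ω in A, ∫⁻ t, tailSup X φ x s ω t ∂killLaw r ∂P =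
      ∫⁻ ω in A, ENNReal.ofReal (Real.exp (-(r * s))) * killedValue P X r φ (x + X s ω) ∂P := by
  simp_rw [← exp_mul_killedSup hr]
  rw [lintegral_const_mul' _ _ ENNReal.ofReal_ne_top,
    lintegral_const_mul' _ _ ENNReal.ofReal_ne_top]
  congr 1
  exact hX.lintegral_incrPath (by positivity) hA
    ((hX.adapted s (by positivity)).measurable.const_add x) (measurable_killedSup r hφ)

theorem IsLevy.measurable_lintegral_tailSup (hX : IsLevy P ℱ X) {r : ℝ} (hr : 0 ≤ r)
    {φ : ℝ → ℝ≥0∞} (hφ : Measurable φ) (x : ℝ) (s : ℚ≥0) :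
    Measurable fun ω => ∫⁻ t, tailSup X φ x s ω t ∂killLaw r := by
  simp_rw [← exp_mul_killedSup hr]
  exact ((measurable_killedSup r hφ).comp (((hX.measurable (by positivity)).const_add x).prodMk
    (hX.measurable_incrPath (by positivity)))).const_mul _

theorem killedValue_anti (r : ℝ) {φ : ℝ → ℝ≥0∞} (hφ : Antitone φ) :
    Antitone (killedValue P X r φ) := by
  intro z z' hz
  refine lintegral_mono fun ω => lintegral_mono fun t => iSup_mono fun q => ?_
  dsimp only
  split_ifs
  · exact hφ (by linarith)
  · exact le_rfl

theorem IsLevy.killedValue_eq (hX : IsLevy P ℱ X) (r : ℝ) {φ : ℝ → ℝ≥0∞} (hφ : Measurable φ)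
    (z : ℝ) : killedValue P X r φ z =
      ∫⁻ t, ∫⁻ ω, ⨆ q : ℚ≥0, (if ENNReal.ofReal q < t then φ (z + incrPath X 0 ω q) else 0) ∂P
        ∂killLaw r := by
  have := hX.isProb
  have := isProbabilityMeasure_killLaw r
  refine lintegral_lintegral_swap (Measurable.aemeasurable ?_)
  exact (measurable_iSup_before hφ).comp (((measurable_const.prodMk
    (hX.measurable_incrPath le_rfl)).comp measurable_fst).prodMk measurable_snd)

theorem IsLevy.measurable_iSup_incrPath (hX : IsLevy P ℱ X) {φ : ℝ → ℝ≥0∞} (hφ : Measurable φ)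
    (z : ℝ) (t : ℝ≥0∞) : Measurable fun ω =>
      ⨆ q : ℚ≥0, (if ENNReal.ofReal q < t then φ (z + incrPath X 0 ω q) else 0) :=
  (measurable_iSup_before hφ).comp ((measurable_const.prodMk
    (hX.measurable_incrPath le_rfl)).prodMk measurable_const)

theorem IsLevy.measurable_lintegral_iSup_incrPath (hX : IsLevy P ℱ X) {φ : ℝ → ℝ≥0∞}
    (hφ : Measurable φ) (z : ℝ) : Measurable fun t => ∫⁻ ω,
      ⨆ q : ℚ≥0, (if ENNReal.ofReal q < t then φ (z + incrPath X 0 ω q) else 0) ∂P := by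
  have := hX.isProb
  exact ((measurable_iSup_before hφ).comp (((measurable_const.prodMk
    (hX.measurable_incrPath le_rfl)).comp measurable_snd).prodMk
      measurable_fst)).lintegral_prod_right'

/-- The payoff `(K - e^a / m)^+`. -/
def scaledPut (K m a : ℝ) : ℝ≥0∞ := ENNReal.ofReal (K - Real.exp a / m)

theorem continuous_scaledPut (K m : ℝ) : Continuous (scaledPut K m) := by
  unfold scaledPut
  exact ENNReal.continuous_ofReal.comp (by fun_prop)

theorem antitone_scaledPut (K : ℝ) {m : ℝ} (hm : 0 < m) : Antitone (scaledPut K m) :=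
  fun _ _ h => ENNReal.ofReal_le_ofReal
    (sub_le_sub_left (div_le_div_of_nonneg_right (Real.exp_le_exp.2 h) hm.le) K)

theorem scaledPut_le (K : ℝ) {m : ℝ} (hm : 0 < m) (a : ℝ) : scaledPut K m a ≤ ENNReal.ofReal K :=
  ENNReal.ofReal_le_ofReal (sub_le_self _ (by positivity))

theorem scaledPut_eq_zero {K m a : ℝ} (hK : 0 < K) (hm : 0 < m) (ha : Real.log (K * m) ≤ a) :
    scaledPut K m a = 0 := by
  rw [Real.log_le_iff_le_exp (by positivity)] at ha
  exact ENNReal.ofReal_eq_zero.2 (sub_nonpos.2 ((le_div_iff₀ hm).2 ha))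

theorem IsLevy.incrPath_zero_ae (hX : IsLevy P ℱ X) :
    ∀ᵐ ω ∂P, ∀ q : ℚ≥0, incrPath X 0 ω q = X q ω := by
  filter_upwards [hX.zero] with ω h0 q
  simp [incrPath, h0]

section

variable {r K : ℝ}

theorem IsLevy.le_lintegral_iSup_add (hX : IsLevy P ℱ X) {m : ℝ} (hm : 0 < m)
    (z : ℝ) {ε : ℝ} (hε : 0 < ε) (t : ℝ≥0∞) :
    ENNReal.ofReal K ≤ (∫⁻ ω, ⨆ q : ℚ≥0, (if ENNReal.ofReal q < ENNReal.ofReal ε + t then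
        scaledPut K m (z + incrPath X 0 ω q) else 0) ∂P) +
      ENNReal.ofReal (Real.exp z / m) * ∫⁻ ω, ENNReal.ofReal (Real.exp (infTo X t ω)) ∂P := by
  have := hX.isProb
  rw [← lintegral_const_mul' _ _ ENNReal.ofReal_ne_top, ← lintegral_add_left
    (hX.measurable_iSup_incrPath (continuous_scaledPut K m).measurable z _)]
  refine le_trans (by simp) (lintegral_mono_ae (f := fun _ => ENNReal.ofReal K) ?_)
  filter_upwards [hX.incrPath_zero_ae] with ω hω
  simp only [hω]
  set A := ⨆ q : ℚ≥0, (if ENNReal.ofReal q < ENNReal.ofReal ε + t then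
    scaledPut K m (z + X q ω) else 0)
  have h1 : ∀ a, infTo X t ω < a → scaledPut K m (z + a) ≤ A := by
    intro a ha
    obtain ⟨s, hs0, hst, hs⟩ := exists_lt_of_infTo_lt ha
    obtain ⟨q, hsq, hq, hqa⟩ := exists_nnrat_lt_of_lt hs0 (hX.rightCont ω s hs0) hs hε
    have h2 : ENNReal.ofReal q < ENNReal.ofReal ε + t := by
      calc ENNReal.ofReal q < ENNReal.ofReal (ε + s) :=
            (ENNReal.ofReal_lt_ofReal_iff_of_nonneg (by positivity)).2 (by linarith)
        _ = ENNReal.ofReal ε + ENNReal.ofReal s := ENNReal.ofReal_add hε.le hs0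
        _ ≤ _ := by gcongr
    refine le_trans ?_ (le_iSup _ q)
    rw [if_pos h2]
    exact antitone_scaledPut K hm (by linarith)
  have h3 : scaledPut K m (z + infTo X t ω) ≤ A := by
    have hc : Tendsto (fun a => scaledPut K m (z + a))
        (nhdsWithin (infTo X t ω) (Ioi (infTo X t ω)))
        (nhds (scaledPut K m (z + infTo X t ω))) :=
      (((continuous_scaledPut K m).comp (continuous_const_add z)).tendsto _).mono_left
        nhdsWithin_le_nhds
    exact le_of_tendsto hc (eventually_mem_nhdsWithin.mono h1)
  refine le_trans ?_ (add_le_add_left h3 _)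
  rw [scaledPut, ← ENNReal.ofReal_mul (by positivity)]
  refine le_trans (ENNReal.ofReal_le_ofReal ?_) ENNReal.ofReal_add_le
  rw [Real.exp_add]
  apply le_of_eq
  ring

theorem ofReal_exp_div_mul {m : ℝ} (hm : 0 < m) (z : ℝ) :
    ENNReal.ofReal (Real.exp z / m) * ENNReal.ofReal m = ENNReal.ofReal (Real.exp z) := by
  rw [← ENNReal.ofReal_mul (by positivity), div_mul_cancel₀ _ hm.ne']

theorem IsLevy.le_killedValue (hX : IsLevy P ℱ X)
    (hr : 0 < r ∨ (r = 0 ∧ P {ω | Tendsto (fun t => X t ω) atTop atTop} = 1)) (z : ℝ) :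
    ENNReal.ofReal (K - Real.exp z) ≤ killedValue P X r (scaledPut K (mInf P X r)) z := by
  have := isProbabilityMeasure_killLaw r
  have hm := hX.mInf_pos hr
  have hr0 : 0 ≤ r := hr.elim le_of_lt fun h => h.1.ge
  set m := mInf P X r
  have hφ := (continuous_scaledPut K m).measurable
  set G : ℝ≥0∞ → ℝ≥0∞ := fun t => ∫⁻ ω,
    ⨆ q : ℚ≥0, (if ENNReal.ofReal q < t then scaledPut K m (z + incrPath X 0 ω q) else 0) ∂P
  have hGm : Measurable G := hX.measurable_lintegral_iSup_incrPath hφ z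
  have key : ∀ ε : ℝ, 0 < ε → ENNReal.ofReal (Real.exp (-(r * ε))) *
      ENNReal.ofReal (K - Real.exp z) ≤ killedValue P X r (scaledPut K m) z := by
    intro ε hε
    have h1 : ENNReal.ofReal K ≤ (∫⁻ t, G (ENNReal.ofReal ε + t) ∂killLaw r) +
        ENNReal.ofReal (Real.exp z) := by
      have h2 : ∫⁻ _, ENNReal.ofReal K ∂killLaw r ≤ ∫⁻ t, (G (ENNReal.ofReal ε + t) +
          ENNReal.ofReal (Real.exp z / m) * ∫⁻ ω, ENNReal.ofReal (Real.exp (infTo X t ω)) ∂P)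
            ∂killLaw r := lintegral_mono fun t => hX.le_lintegral_iSup_add (K := K) hm z hε t
      rwa [lintegral_const, measure_univ, mul_one, lintegral_add_left
        (f := fun t => G (ENNReal.ofReal ε + t)) (hGm.comp (measurable_const_add _)),
        lintegral_const_mul' _ _ ENNReal.ofReal_ne_top,
        ← hX.ofReal_mInf hr, ofReal_exp_div_mul hm] at h2
    rw [hX.killedValue_eq r hφ]
    calc _ ≤ ENNReal.ofReal (Real.exp (-(r * ε))) * ∫⁻ t, G (ENNReal.ofReal ε + t) ∂killLaw r := by
          gcongr
          rw [ENNReal.ofReal_sub _ (Real.exp_pos z).le]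
          exact tsub_le_iff_right.2 h1
      _ = ∫⁻ t in Ioi (ENNReal.ofReal ε), G t ∂killLaw r :=
          (setLIntegral_killLaw hr0 hε.le hGm).symm
      _ ≤ _ := setLIntegral_le_lintegral _ _
  have hlim : Tendsto (fun ε : ℝ => ENNReal.ofReal (Real.exp (-(r * ε)) * (K - Real.exp z)))
      (nhdsWithin 0 (Ioi 0)) (nhds (ENNReal.ofReal (Real.exp (-(r * 0)) * (K - Real.exp z)))) := by
    have : Continuous fun ε : ℝ => ENNReal.ofReal (Real.exp (-(r * ε)) * (K - Real.exp z)) :=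
      ENNReal.continuous_ofReal.comp (by fun_prop)
    exact (this.tendsto 0).mono_left nhdsWithin_le_nhds
  simp only [mul_zero, neg_zero, Real.exp_zero, one_mul] at hlim
  refine le_of_tendsto hlim (eventually_mem_nhdsWithin.mono fun ε hε => ?_)
  rw [ENNReal.ofReal_mul (Real.exp_pos _).le]
  exact key ε hε

theorem IsLevy.killedValue_le (hX : IsLevy P ℱ X) (hK : 0 < K)
    (hr : 0 < r ∨ (r = 0 ∧ P {ω | Tendsto (fun t => X t ω) atTop atTop} = 1)) {z : ℝ}
    (hz : z ≤ Real.log (K * mInf P X r)) :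
    killedValue P X r (scaledPut K (mInf P X r)) z ≤ ENNReal.ofReal (K - Real.exp z) := by
  have := hX.isProb
  have := isProbabilityMeasure_killLaw r
  have hm := hX.mInf_pos hr
  have hofm := hX.ofReal_mInf hr
  set m := mInf P X r
  have hφ := (continuous_scaledPut K m).measurable
  have hzK : Real.exp z / m ≤ K := by
    rw [div_le_iff₀ hm]
    exact (Real.le_log_iff_exp_le (by positivity)).1 hz
  rw [ENNReal.ofReal_sub _ (Real.exp_pos z).le, hX.killedValue_eq r hφ]
  refine ENNReal.le_sub_of_add_le_right ENNReal.ofReal_ne_top ?_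
  rw [← ofReal_exp_div_mul hm z, hofm, ← lintegral_const_mul' _ _ ENNReal.ofReal_ne_top,
    ← lintegral_add_left (hX.measurable_lintegral_iSup_incrPath hφ z)]
  refine (lintegral_mono_ae (g := fun _ => ENNReal.ofReal K) ?_).trans (by simp)
  filter_upwards [hX.bddBelow_killLaw hr] with t hb
  rw [← lintegral_const_mul' _ _ ENNReal.ofReal_ne_top, ← lintegral_add_left
    (hX.measurable_iSup_incrPath hφ z t)]
  refine (lintegral_mono_ae (g := fun _ => ENNReal.ofReal K) ?_).trans (by simp)
  filter_upwards [hX.incrPath_zero_ae, hb, hX.infTo_nonpos hb] with ω hω hbω hI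
  simp only [hω]
  have hc : Real.exp z / m * Real.exp (infTo X t ω) ≤ K :=
    (mul_le_of_le_one_right (by positivity) (Real.exp_le_one_iff.2 hI)).trans hzK
  calc _ ≤ ENNReal.ofReal (K - Real.exp z / m * Real.exp (infTo X t ω)) +
        ENNReal.ofReal (Real.exp z / m) * ENNReal.ofReal (Real.exp (infTo X t ω)) := by
        gcongr
        refine iSup_le fun q => ?_
        split_ifs with hq
        · refine ENNReal.ofReal_le_ofReal ?_
          have h1 : infTo X t ω ≤ X q ω := csInf_le hbω ⟨q, ⟨by positivity, hq.le⟩, rfl⟩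
          have h2 := mul_le_mul_of_nonneg_left (Real.exp_le_exp.2 h1)
            (div_pos (Real.exp_pos z) hm).le
          have h3 : Real.exp (z + X q ω) / m = Real.exp z / m * Real.exp (X q ω) := by
            rw [Real.exp_add]; ring
          rw [h3]
          linarith
        · exact zero_le
    _ = ENNReal.ofReal K := by
        rw [← ENNReal.ofReal_mul (by positivity), ← ENNReal.ofReal_add (by linarith)
          (by positivity)]
        ring_nf

/-- The value function is dominated by the payoff frozen above the optimal boundary. -/
theorem IsLevy.killedValue_le_min (hX : IsLevy P ℱ X) (hK : 0 < K)
    (hr : 0 < r ∨ (r = 0 ∧ P {ω | Tendsto (fun t => X t ω) atTop atTop} = 1)) (z : ℝ) :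
    killedValue P X r (scaledPut K (mInf P X r)) z ≤
      ENNReal.ofReal (K - Real.exp (min z (Real.log (K * mInf P X r)))) :=
  (killedValue_anti r (antitone_scaledPut K (hX.mInf_pos hr)) (min_le_left _ _)).trans
    (hX.killedValue_le hK hr (min_le_right _ _))

end

end Value

section Grid

/-- The approximation of `τ` from above on the grid of step `1 / (n + 1)`. -/
def ceilTime (τ : Ω → ℝ≥0∞) (n : ℕ) (ω : Ω) : ℚ≥0 := ⌈(τ ω).toReal * (n + 1)⌉₊ / (n + 1)

theorem toReal_le_ceilTime (τ : Ω → ℝ≥0∞) (n : ℕ) (ω : Ω) : (τ ω).toReal ≤ ceilTime τ n ω := by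
  rw [ceilTime]
  push_cast
  rw [le_div_iff₀ (by positivity)]
  exact Nat.le_ceil _

theorem tendsto_ceilTime (τ : Ω → ℝ≥0∞) (ω : Ω) :
    Tendsto (fun n => (ceilTime τ n ω : ℝ)) atTop (nhds (τ ω).toReal) := by
  have h := (tendsto_nat_ceil_mul_div_atTop (R := ℝ) (a := (τ ω).toReal)
    ENNReal.toReal_nonneg).comp
      ((tendsto_natCast_atTop_atTop (R := ℝ)).comp (tendsto_add_atTop_nat 1))
  refine h.congr fun n => ?_
  simp [ceilTime]

variable [m0 : MeasurableSpace Ω] {P : Measure Ω} {ℱ : Filtration ℝ m0} {X : ℝ → Ω → ℝ}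
  {τ : Ω → ℝ≥0∞}

theorem IsStopTime.measurable (hτ : IsStopTime ℱ τ) : Measurable τ := by
  refine measurable_of_Iic fun a => ?_
  by_cases ha : a = ∞
  · simp [ha]
  · have h := ℱ.le _ _ (hτ a.toReal ENNReal.toReal_nonneg)
    rwa [ENNReal.ofReal_toReal ha] at h

theorem measurable_apply_ceilTime {β : Type*} [MeasurableSpace β] (hτ : Measurable τ)
    {a : ℚ≥0 → Ω → β} (ha : ∀ q, Measurable (a q)) (n : ℕ) :
    Measurable fun ω => a (ceilTime τ n ω) ω := by
  have hN : Measurable fun ω => ⌈(τ ω).toReal * (n + 1)⌉₊ :=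
    Nat.measurable_ceil.comp (hτ.ennreal_toReal.mul_const _)
  exact (measurable_from_prod_countable_right
    (f := fun p : ℕ × Ω => a (p.1 / (n + 1)) p.2) fun k => ha (k / (n + 1))).comp
      (hN.prodMk measurable_id)

theorem IsStopTime.measurableSet_ceil_eq (hτ : IsStopTime ℱ τ) (n k : ℕ) :
    MeasurableSet[ℱ ((k / (n + 1) : ℚ≥0) : ℝ)]
      {ω | τ ω ≠ ∞ ∧ ⌈(τ ω).toReal * (n + 1)⌉₊ = k} := by
  have hset : ∀ j : ℕ, {ω | τ ω ≤ ENNReal.ofReal ((j / (n + 1) : ℚ≥0) : ℝ)} =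
      {ω | τ ω ≠ ∞ ∧ ⌈(τ ω).toReal * (n + 1)⌉₊ ≤ j} := by
    intro j
    ext ω
    simp only [mem_ofPred_eq, Nat.ceil_le]
    rw [← le_div_iff₀ (by positivity)]
    push_cast
    constructor
    · intro h
      have hne := ne_top_of_le_ne_top ENNReal.ofReal_ne_top h
      exact ⟨hne, (ENNReal.le_ofReal_iff_toReal_le hne (by positivity)).1 h⟩
    · exact fun h => (ENNReal.le_ofReal_iff_toReal_le h.1 (by positivity)).2 h.2
  have hm : ∀ j ≤ k, MeasurableSet[ℱ ((k / (n + 1) : ℚ≥0) : ℝ)]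
      {ω | τ ω ≠ ∞ ∧ ⌈(τ ω).toReal * (n + 1)⌉₊ ≤ j} := by
    intro j hj
    rw [← hset]
    refine ℱ.mono ?_ _ (hτ _ (by positivity))
    push_cast
    gcongr
  have heq : {ω | τ ω ≠ ∞ ∧ ⌈(τ ω).toReal * (n + 1)⌉₊ = k} =
      {ω | τ ω ≠ ∞ ∧ ⌈(τ ω).toReal * (n + 1)⌉₊ ≤ k} \
        ⋃ j ∈ Iio k, {ω | τ ω ≠ ∞ ∧ ⌈(τ ω).toReal * (n + 1)⌉₊ ≤ j} := by
    ext ω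
    simp only [mem_ofPred_eq, Set.mem_sdiff, mem_iUnion, mem_Iio, exists_prop, not_exists, not_and]
    constructor
    · rintro ⟨h1, h2⟩
      exact ⟨⟨h1, h2.le⟩, fun j hj _ => by omega⟩
    · rintro ⟨⟨h1, h2⟩, h3⟩
      exact ⟨h1, h2.eq_of_not_lt fun h => h3 _ h h1 le_rfl⟩
  rw [heq]
  exact (hm k le_rfl).diff (MeasurableSet.biUnion (to_countable _) fun j hj => hm j (le_of_lt hj))

/-- Equality of integrals over past events at fixed times extends to discretised stopping times. -/
theorem IsStopTime.setLIntegral_ceilTime_congr (hτ : IsStopTime ℱ τ) {a b : ℚ≥0 → Ω → ℝ≥0∞}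
    (hab : ∀ (s : ℚ≥0) (A : Set Ω), MeasurableSet[ℱ s] A →
      ∫⁻ ω in A, a s ω ∂P = ∫⁻ ω in A, b s ω ∂P) (n : ℕ) :
    ∫⁻ ω in {ω | τ ω ≠ ∞}, a (ceilTime τ n ω) ω ∂P =
      ∫⁻ ω in {ω | τ ω ≠ ∞}, b (ceilTime τ n ω) ω ∂P := by
  set A : ℕ → Set Ω := fun k => {ω | τ ω ≠ ∞ ∧ ⌈(τ ω).toReal * (n + 1)⌉₊ = k} with hA
  have hAm : ∀ k, MeasurableSet (A k) := fun k => ℱ.le _ _ (hτ.measurableSet_ceil_eq n k)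
  have hd : Pairwise (Function.onFun Disjoint A) := by
    intro i j hij
    refine Set.disjoint_left.2 fun ω h1 h2 => hij (h1.2.symm.trans h2.2)
  have hU : {ω | τ ω ≠ ∞} = ⋃ k, A k := by
    ext ω
    simp [hA]
  have key : ∀ c : ℚ≥0 → Ω → ℝ≥0∞, ∫⁻ ω in {ω | τ ω ≠ ∞}, c (ceilTime τ n ω) ω ∂P =
      ∑' k : ℕ, ∫⁻ ω in A k, c (k / (n + 1)) ω ∂P := by
    intro c
    rw [hU, lintegral_iUnion hAm hd]
    refine tsum_congr fun k => setLIntegral_congr_fun (hAm k) fun ω hω => ?_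
    simp only [ceilTime, hω.2]
  rw [key, key]
  exact tsum_congr fun k => hab _ _ (hτ.measurableSet_ceil_eq n k)

end Grid

section Optimal

theorem putPayoff_nonneg (X : ℝ → Ω → ℝ) (r K x : ℝ) (τ : Ω → ℝ≥0∞) (ω : Ω) :
    0 ≤ putPayoff X r K x τ ω := by
  unfold putPayoff stopPayoff
  split_ifs <;> positivity

theorem tailSup_eq_zero_of_hitBelowE_eq_top {X : ℝ → Ω → ℝ} {φ : ℝ → ℝ≥0∞} {x y : ℝ}
    (hy : ∀ a, y ≤ a → φ a = 0) {ω : Ω} (h : hitBelowE X y x ω = ∞) (t : ℝ≥0∞) :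
    tailSup X φ x 0 ω t = 0 := by
  refine le_antisymm (iSup_le fun q => ?_) zero_le
  split_ifs
  · refine (hy _ ?_).le
    by_contra! hlt
    exact absurd (hitBelowE_le q hlt) (by simp [h])
  · exact le_rfl

variable [m0 : MeasurableSpace Ω] {P : Measure Ω} {ℱ : Filtration ℝ m0} {X : ℝ → Ω → ℝ}
  {r K : ℝ} {τ : Ω → ℝ≥0∞}

theorem IsLevy.tendsto_apply_ceilTime (hX : IsLevy P ℱ X) (τ : Ω → ℝ≥0∞) (ω : Ω) :
    Tendsto (fun n => X (ceilTime τ n ω) ω) atTop (nhds (X (τ ω).toReal ω)) :=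
  (hX.rightCont ω _ ENNReal.toReal_nonneg).tendsto.comp (tendsto_nhdsWithin_iff.2
    ⟨tendsto_ceilTime τ ω, Eventually.of_forall fun n => toReal_le_ceilTime τ n ω⟩)

theorem IsLevy.tendsto_discounted_ceilTime (hX : IsLevy P ℱ X) (r : ℝ) {g : ℝ → ℝ}
    (hg : Continuous g) (x : ℝ) (τ : Ω → ℝ≥0∞) (ω : Ω) :
    Tendsto (fun n => ENNReal.ofReal
        (Real.exp (-(r * ceilTime τ n ω)) * g (x + X (ceilTime τ n ω) ω))) atTop
      (nhds (ENNReal.ofReal (Real.exp (-(r * (τ ω).toReal)) * g (x + X (τ ω).toReal ω)))) := by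
  have h : Continuous fun p : ℝ × ℝ => ENNReal.ofReal (Real.exp (-(r * p.1)) * g (x + p.2)) :=
    ENNReal.continuous_ofReal.comp (by fun_prop)
  have hp : Tendsto (fun n => ((ceilTime τ n ω : ℝ), X (ceilTime τ n ω) ω)) atTop
      (nhds ((τ ω).toReal, X (τ ω).toReal ω)) :=
    (tendsto_ceilTime τ ω).prodMk_nhds (hX.tendsto_apply_ceilTime τ ω)
  have := (h.tendsto _).comp hp
  exact this

theorem IsLevy.measurable_discounted (hX : IsLevy P ℱ X) (r : ℝ) {g : ℝ → ℝ}
    (hg : Continuous g) (x : ℝ) (q : ℚ≥0) :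
    Measurable fun ω => ENNReal.ofReal (Real.exp (-(r * q)) * g (x + X q ω)) :=
  ((hg.measurable.comp ((hX.measurable (by positivity)).const_add x)).const_mul _).ennreal_ofReal

theorem IsLevy.measurable_putPayoff (hX : IsLevy P ℱ X) (hτ : IsStopTime ℱ τ) (r K x : ℝ) :
    Measurable (putPayoff X r K x τ) := by
  refine Measurable.ite (hτ.measurable (measurableSet_singleton ∞).compl) ?_ measurable_const
  have hXτ : Measurable fun ω => X (τ ω).toReal ω :=
    measurable_of_tendsto_metrizable (fun n => measurable_apply_ceilTime hτ.measurable
      (a := fun q ω => X q ω) (fun q => hX.measurable (by positivity)) n)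
      (tendsto_pi_nhds.2 fun ω => hX.tendsto_apply_ceilTime τ ω)
  exact (Real.measurable_exp.comp (hτ.measurable.ennreal_toReal.const_mul r).neg).mul
    ((measurable_const.sub (Real.measurable_exp.comp (hXτ.const_add x))).max measurable_const)

theorem lintegral_putPayoff (hτ : Measurable τ) (X : ℝ → Ω → ℝ) (r K x : ℝ) :
    ∫⁻ ω, ENNReal.ofReal (putPayoff X r K x τ ω) ∂P = ∫⁻ ω in {ω | τ ω ≠ ∞},
      ENNReal.ofReal (Real.exp (-(r * (τ ω).toReal)) *
        (K - Real.exp (x + X (τ ω).toReal ω))) ∂P := by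
  have hT : MeasurableSet {ω | τ ω ≠ ∞} := hτ (measurableSet_singleton ∞).compl
  rw [← lintegral_indicator hT]
  refine lintegral_congr fun ω => ?_
  rw [Set.indicator_apply, putPayoff, stopPayoff]
  by_cases h : τ ω = ∞
  · simp [h]
  · have h' : ω ∈ {ω | τ ω ≠ ∞} := h
    rw [if_pos h, if_pos h', ENNReal.ofReal_mul (Real.exp_pos _).le,
      ENNReal.ofReal_mul (Real.exp_pos _).le]
    simp [ENNReal.ofReal_max]

/-- The expected running maximum of the scaled payoff bounds the value of every stopping time. -/
theorem IsLevy.lintegral_putPayoff_le (hX : IsLevy P ℱ X)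
    (hr : 0 < r ∨ (r = 0 ∧ P {ω | Tendsto (fun t => X t ω) atTop atTop} = 1))
    (hτ : IsStopTime ℱ τ) (x : ℝ) :
    ∫⁻ ω, ENNReal.ofReal (putPayoff X r K x τ ω) ∂P ≤
      ∫⁻ ω, ∫⁻ t, tailSup X (scaledPut K (mInf P X r)) x 0 ω t ∂killLaw r ∂P := by
  have hr0 : 0 ≤ r := hr.elim le_of_lt fun h => h.1.ge
  have hg : Continuous fun a => K - Real.exp a := by fun_prop
  rw [lintegral_putPayoff hτ.measurable]
  simp_rw [← fun ω => (hX.tendsto_discounted_ceilTime r hg x τ ω).liminf_eq]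
  refine (lintegral_liminf_le fun n => measurable_apply_ceilTime hτ.measurable
    (fun q => hX.measurable_discounted r hg x q) n).trans ?_
  refine liminf_le_of_frequently_le' (Frequently.of_forall fun n => ?_)
  calc _ ≤ ∫⁻ ω in {ω | τ ω ≠ ∞}, ENNReal.ofReal (Real.exp (-(r * ceilTime τ n ω))) *
        killedValue P X r (scaledPut K (mInf P X r)) (x + X (ceilTime τ n ω) ω) ∂P := by
        refine lintegral_mono fun ω => ?_
        rw [ENNReal.ofReal_mul (Real.exp_pos _).le]
        gcongr
        exact hX.le_killedValue hr _
    _ = ∫⁻ ω in {ω | τ ω ≠ ∞}, ∫⁻ t,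
        tailSup X (scaledPut K (mInf P X r)) x (ceilTime τ n ω) ω t ∂killLaw r ∂P :=
        (hτ.setLIntegral_ceilTime_congr (fun s A hA => hX.setLIntegral_tailSup hr0
          (continuous_scaledPut K _).measurable x s hA) n).symm
    _ ≤ ∫⁻ ω in {ω | τ ω ≠ ∞}, ∫⁻ t,
        tailSup X (scaledPut K (mInf P X r)) x 0 ω t ∂killLaw r ∂P :=
        lintegral_mono fun ω => lintegral_mono fun t => tailSup_anti X _ x _ ω t
    _ ≤ _ := setLIntegral_le_lintegral _ _

theorem IsLevy.tailSup_zero_le_liminf (hX : IsLevy P ℱ X) {φ : ℝ → ℝ≥0∞} (hφ : Continuous φ)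
    {y : ℝ} (hy : ∀ a, y ≤ a → φ a = 0) (x : ℝ) (ω : Ω) (t : ℝ≥0∞) :
    tailSup X φ x 0 ω t ≤
      liminf (fun n => tailSup X φ x (ceilTime (hitBelowE X y x) n ω) ω t) atTop := by
  refine iSup_le fun q => ?_
  split_ifs with hq
  swap
  · exact zero_le
  rcases le_or_gt y (x + X q ω) with h | h
  · rw [hy _ h]
    exact zero_le
  set τ := hitBelowE X y x
  have hτq : (τ ω).toReal ≤ q :=
    ENNReal.toReal_le_of_le_ofReal (by positivity) (hitBelowE_le q h)
  have hlim : Tendsto (fun n => ((max q (ceilTime τ n ω) : ℚ≥0) : ℝ)) atTop (nhds q) := by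
    have h1 := (tendsto_const_nhds (x := (q : ℝ))).max (tendsto_ceilTime τ ω)
    rw [max_eq_left hτq] at h1
    exact h1.congr fun n => by push_cast; rfl
  have hXlim : Tendsto (fun n => φ (x + X ((max q (ceilTime τ n ω) : ℚ≥0) : ℝ) ω)) atTop
      (nhds (φ (x + X q ω))) := by
    refine (hφ.tendsto _).comp (Tendsto.const_add x ?_)
    refine (hX.rightCont ω q (by positivity)).tendsto.comp (tendsto_nhdsWithin_iff.2
      ⟨hlim, Eventually.of_forall fun n => ?_⟩)
    have h2 : q ≤ max q (ceilTime τ n ω) := le_max_left _ _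
    rw [mem_Ici]
    exact_mod_cast h2
  rw [← hXlim.liminf_eq]
  refine liminf_le_liminf ?_
  filter_upwards [(ENNReal.tendsto_ofReal hlim).eventually_lt_const hq.2] with n hn
  exact le_tailSup (le_max_right _ _) hn

/-- The first passage time attains the expected running maximum of the scaled payoff. -/
theorem IsLevy.le_lintegral_putPayoff_hitBelowE (hX : IsLevy P ℱ X) (hK : 0 < K)
    (hr : 0 < r ∨ (r = 0 ∧ P {ω | Tendsto (fun t => X t ω) atTop atTop} = 1)) (x : ℝ) :
    ∫⁻ ω, ∫⁻ t, tailSup X (scaledPut K (mInf P X r)) x 0 ω t ∂killLaw r ∂P ≤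
      ∫⁻ ω, ENNReal.ofReal
        (putPayoff X r K x (hitBelowE X (Real.log (K * mInf P X r)) x) ω) ∂P := by
  have := hX.isProb
  have hr0 : 0 ≤ r := hr.elim le_of_lt fun h => h.1.ge
  set y := Real.log (K * mInf P X r)
  set φ := scaledPut K (mInf P X r)
  set τ := hitBelowE X y x
  have hτ : IsStopTime ℱ τ := hX.isStopTime_hitBelowE y x
  have hφ : Continuous φ := continuous_scaledPut K _
  have hy : ∀ a, y ≤ a → φ a = 0 := fun a ha => scaledPut_eq_zero hK (hX.mInf_pos hr) ha
  have hT : MeasurableSet {ω | τ ω ≠ ∞} := hτ.measurable (measurableSet_singleton ∞).compl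
  have hg : Continuous fun a => K - Real.exp (min a y) := by fun_prop
  have hlim : Tendsto (fun n => ∫⁻ ω in {ω | τ ω ≠ ∞}, ENNReal.ofReal
      (Real.exp (-(r * ceilTime τ n ω)) * (K - Real.exp (min (x + X (ceilTime τ n ω) ω) y))) ∂P)
      atTop (nhds (∫⁻ ω in {ω | τ ω ≠ ∞}, ENNReal.ofReal
        (Real.exp (-(r * (τ ω).toReal)) * (K - Real.exp (min (x + X (τ ω).toReal ω) y))) ∂P)) := by
    refine tendsto_lintegral_of_dominated_convergence (fun _ => ENNReal.ofReal K)
      (fun n => measurable_apply_ceilTime hτ.measurable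
        (fun q => hX.measurable_discounted r hg x q) n) (fun n => ?_) ?_
      (Eventually.of_forall fun ω => hX.tendsto_discounted_ceilTime r hg x τ ω)
    · refine Eventually.of_forall fun ω => ENNReal.ofReal_le_ofReal ?_
      have h1 : Real.exp (-(r * ceilTime τ n ω)) ≤ 1 := by
        rw [Real.exp_le_one_iff, neg_nonpos]
        positivity
      calc _ ≤ Real.exp (-(r * ceilTime τ n ω)) * K := by
            gcongr
            exact sub_le_self _ (Real.exp_pos _).le
        _ ≤ K := mul_le_of_le_one_left hK.le h1
    · rw [lintegral_const]
      exact ENNReal.mul_ne_top ENNReal.ofReal_ne_top (measure_ne_top _ _)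
  calc _ ≤ ∫⁻ ω in {ω | τ ω ≠ ∞}, ∫⁻ t, tailSup X φ x 0 ω t ∂killLaw r ∂P := by
        rw [← lintegral_indicator hT]
        refine lintegral_mono fun ω => ?_
        rw [Set.indicator_apply]
        split_ifs with h
        · exact le_rfl
        · simp [tailSup_eq_zero_of_hitBelowE_eq_top hy (not_not.1 h)]
    _ ≤ ∫⁻ ω in {ω | τ ω ≠ ∞},
        liminf (fun n => ∫⁻ t, tailSup X φ x (ceilTime τ n ω) ω t ∂killLaw r) atTop ∂P :=
        lintegral_mono fun ω => (lintegral_mono fun t =>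
          hX.tailSup_zero_le_liminf hφ hy x ω t).trans
            (lintegral_liminf_le fun n => measurable_tailSup_right X φ x _ ω)
    _ ≤ liminf (fun n => ∫⁻ ω in {ω | τ ω ≠ ∞},
        ∫⁻ t, tailSup X φ x (ceilTime τ n ω) ω t ∂killLaw r ∂P) atTop :=
        lintegral_liminf_le fun n => measurable_apply_ceilTime hτ.measurable
          (fun q => hX.measurable_lintegral_tailSup hr0 hφ.measurable x q) n
    _ ≤ liminf (fun n => ∫⁻ ω in {ω | τ ω ≠ ∞}, ENNReal.ofReal
        (Real.exp (-(r * ceilTime τ n ω)) *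
          (K - Real.exp (min (x + X (ceilTime τ n ω) ω) y))) ∂P) atTop := by
        refine liminf_le_liminf (Eventually.of_forall fun n => ?_)
        rw [hτ.setLIntegral_ceilTime_congr (fun s A hA => hX.setLIntegral_tailSup hr0
          hφ.measurable x s hA) n]
        refine lintegral_mono fun ω => ?_
        rw [ENNReal.ofReal_mul (Real.exp_pos _).le]
        gcongr
        exact hX.killedValue_le_min hK hr _
    _ = _ := by
        rw [hlim.liminf_eq, lintegral_putPayoff hτ.measurable]
        refine setLIntegral_congr_fun hT fun ω hω => ?_
        rw [min_eq_left (add_apply_hitBelowE_le (hX.rightCont ω) hω)]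

end Optimal

theorem stmt10 [m0 : MeasurableSpace Ω] (P : Measure Ω) (ℱ : Filtration ℝ m0)
    (X : ℝ → Ω → ℝ) (hX : IsLevy P ℱ X) (r K : ℝ) (hK : 0 < K)
    (hr : 0 < r ∨ (r = 0 ∧ P {ω | Tendsto (fun t => X t ω) atTop atTop} = 1))
    (x : ℝ) :
    IsStopTime ℱ (hitBelowE X (Real.log (K * mInf P X r)) x) ∧
    (∫ ω, putPayoff X r K x (hitBelowE X (Real.log (K * mInf P X r)) x) ω ∂P) =
      putValue P ℱ X r K x := by
  have := hX.isProb
  have hτ₀ := hX.isStopTime_hitBelowE (Real.log (K * mInf P X r)) x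
  refine ⟨hτ₀, ?_⟩
  have heq : ∀ τ, IsStopTime ℱ τ → ∫ ω, putPayoff X r K x τ ω ∂P =
      (∫⁻ ω, ENNReal.ofReal (putPayoff X r K x τ ω) ∂P).toReal := fun τ hτ =>
    integral_eq_lintegral_of_nonneg_ae (Eventually.of_forall (putPayoff_nonneg X r K x τ))
      (hX.measurable_putPayoff hτ r K x).aestronglyMeasurable
  have hfin : ∫⁻ ω, ENNReal.ofReal
      (putPayoff X r K x (hitBelowE X (Real.log (K * mInf P X r)) x) ω) ∂P ≠ ∞ := by
    refine ((hX.lintegral_putPayoff_le hr hτ₀ x).trans (lintegral_mono fun ω =>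
      lintegral_mono (g := fun _ => ENNReal.ofReal K) fun t => iSup_le fun q => ?_)).trans_lt ?_
      |>.ne
    · split_ifs
      · exact scaledPut_le K (hX.mInf_pos hr) _
      · exact zero_le
    · have := isProbabilityMeasure_killLaw r
      simp
  have hle : ∀ τ, IsStopTime ℱ τ → ∫ ω, putPayoff X r K x τ ω ∂P ≤
      ∫ ω, putPayoff X r K x (hitBelowE X (Real.log (K * mInf P X r)) x) ω ∂P := by
    intro τ hτ
    rw [heq τ hτ, heq _ hτ₀]
    exact ENNReal.toReal_mono hfin ((hX.lintegral_putPayoff_le hr hτ x).trans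
      (hX.le_lintegral_putPayoff_hitBelowE hK hr x))
  have : Nonempty {τ : Ω → ℝ≥0∞ // IsStopTime ℱ τ} := ⟨⟨_, hτ₀⟩⟩
  refine le_antisymm ?_ (ciSup_le fun τ => hle τ.1 τ.2)
  exact le_ciSup (f := fun τ : {τ : Ω → ℝ≥0∞ // IsStopTime ℱ τ} =>
    ∫ ω, putPayoff X r K x τ.1 ω ∂P) ⟨_, forall_mem_range.2 fun τ => hle τ.1 τ.2⟩ ⟨_, hτ₀⟩

end AKLevy
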